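/- arXiv:1402.5366 — 2 statements merged into one kernel-verified Lean document; each statement's English description precedes it below -/
import Mathlib

section
/- For every positive integer n, Σ_k (−1)^k · spt(n − k(3k+1)/2) = a(n), where the sum is over all integers k, spt(m) = 0 for m ≤ 0, and a(n) = −Σ_{ab=6n, 0<a<b} (12 | b²−a²)·a. -/
/-- The partition function `p(n)`. -/
def partitionCount (n : ℕ) : ℕ := Fintype.card (Nat.Partition n)

/-- The smallest part of a partition (`0` for the empty partition). -/
noncomputable def Nat.Partition.smallestPart {n : ℕ} (π : n.Partition) : ℕ := sInf {a | a ∈ π.parts}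

/-- `spt(n)`: the total number of smallest parts in the partitions of `n`. -/
noncomputable def spt (n : ℕ) : ℕ := ∑ π : Nat.Partition n, π.parts.count π.smallestPart

/-- The Kronecker symbol `(12 | m)`. -/
def chi12 (m : ℕ) : ℤ :=
  if m % 12 = 1 ∨ m % 12 = 11 then 1 else if m % 12 = 5 ∨ m % 12 = 7 then -1 else 0

/-- `a(n) = −∑_{ab = 6n, 0 < a < b} (12 | b² − a²) · a`. -/
def sptRHS (n : ℕ) : ℤ :=
  - ∑ a ∈ (6 * n).divisors.filter (fun a => a < 6 * n / a),
      chi12 ((6 * n / a) ^ 2 - a ^ 2) * a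

/-- `s(k) = ∑_{d ∣ k} min(d, k/d)`. -/
def sdiv (k : ℕ) : ℕ := ∑ d ∈ k.divisors, min d (k / d)

/-- `b(n)` from Theorem 2. -/
def bfun (n : ℕ) : ℤ :=
  if n % 2 = 1 then (-1) ^ (n + 1) * (2 * sdiv n)
  else if n % 4 = 0 then (-1) ^ (n + 1) * (4 * sdiv (n / 4))
  else 0

/-- The number of overpartitions of `n`: each partition together with a choice of
a set of part sizes to overline (the first occurrence of each chosen size). -/
def overpartitionCount (n : ℕ) : ℕ :=
  ∑ π : Nat.Partition n, π.parts.toFinset.powerset.card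

/-- `sptbar(n)`: the number of odd smallest parts in the overpartitions of `n`. -/
noncomputable def sptbar (n : ℕ) : ℕ :=
  ∑ π : Nat.Partition n, ∑ _S ∈ π.parts.toFinset.powerset,
    if Odd π.smallestPart then π.parts.count π.smallestPart else 0

/-- `M2(n)`: the number of partitions of `n` without repeated odd parts. -/
def M2 (n : ℕ) : ℕ :=
  (Finset.univ.filter fun π : Nat.Partition n =>
    ∀ i ∈ π.parts, Odd i → π.parts.count i ≤ 1).card

/-- `M2spt(n)`: the number of smallest parts in those partitions of `n` without
repeated odd parts whose smallest part is even. -/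
noncomputable def M2spt (n : ℕ) : ℕ :=
  ∑ π : Nat.Partition n,
    if (∀ i ∈ π.parts, Odd i → π.parts.count i ≤ 1) ∧ Even π.smallestPart ∧ π.parts ≠ 0
    then π.parts.count π.smallestPart else 0

/-- `σ(n)`: sum of divisors. -/
def sigma1 (n : ℕ) : ℕ := ∑ d ∈ n.divisors, d

/-- `c(n) = σ(n) − σ(n/2) − s(2n)/2 + s(n/2)`, with `σ`, `s` vanishing at non-integers. -/
def cfun (n : ℕ) : ℚ :=
  (sigma1 n : ℚ) - (if 2 ∣ n then (sigma1 (n / 2) : ℚ) else 0)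
    - (sdiv (2 * n) : ℚ) / 2 + (if 2 ∣ n then (sdiv (n / 2) : ℚ) else 0)

/-- `p` extended by zero to `ℤ`. -/
def pZ (m : ℤ) : ℤ := if 0 ≤ m then (partitionCount m.toNat : ℤ) else 0

/-- `spt` extended by zero to `ℤ`. -/
noncomputable def sptZ (m : ℤ) : ℤ := if 0 ≤ m then (spt m.toNat : ℤ) else 0

/-- `sptbar` extended by zero to `ℤ`. -/
noncomputable def sptbarZ (m : ℤ) : ℤ := if 0 ≤ m then (sptbar m.toNat : ℤ) else 0

/-- `M2spt` extended by zero to `ℤ`, valued in `ℚ`. -/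
noncomputable def M2sptQ (m : ℤ) : ℚ := if 0 ≤ m then (M2spt m.toNat : ℚ) else 0

open Finset

/-- The finite `q`-Pochhammer product `(q; q)_n = ∏_{i = 1}^n (1 - q ^ i)`. -/
def qPoch {R : Type*} [CommRing R] (q : R) (n : ℕ) : R := ∏ i ∈ range n, (1 - q ^ (i + 1))

section qPoch

variable {R : Type*} [CommRing R] (q : R)

@[simp]
lemma qPoch_zero : qPoch q 0 = 1 := rfl

lemma qPoch_succ (n : ℕ) : qPoch q (n + 1) = qPoch q n * (1 - q ^ (n + 1)) :=
  prod_range_succ _ _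

end qPoch

section BaileyPair

variable {K : Type*} [Field K] {q : K}

lemma qPoch_ne_zero (hq : ∀ n, 1 - q ^ (n + 1) ≠ 0) (n : ℕ) : qPoch q n ≠ 0 :=
  prod_ne_zero_iff.2 fun i _ => hq i

/-- The kernel `1 / ((q)_{n-r} (q)_{n+r})` of a Bailey pair relative to `1`. -/
def baileyKernel (q : K) (n r : ℕ) : K :=
  if r ≤ n then (qPoch q (n - r) * qPoch q (n + r))⁻¹ else 0

lemma baileyKernel_zero_right (q : K) (n : ℕ) : baileyKernel q n 0 = (qPoch q n ^ 2)⁻¹ := by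
  simp [baileyKernel, sq]

lemma baileyKernel_succ_left (hq : ∀ n, 1 - q ^ (n + 1) ≠ 0) {n r : ℕ} (h : r ≤ n + 1) :
    baileyKernel q n r =
      (1 - q ^ (n + 1 - r)) * (1 - q ^ (n + 1 + r)) * baileyKernel q (n + 1) r := by
  rcases h.eq_or_lt with rfl | h
  · simp [baileyKernel]
  · obtain ⟨k, rfl⟩ := Nat.exists_eq_add_of_le (Nat.lt_succ_iff.1 h)
    have h1 := hq k
    have h2 := hq (r + k + r)
    have h3 := qPoch_ne_zero hq k
    have h4 := qPoch_ne_zero hq (r + k + r)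
    rw [baileyKernel, baileyKernel, if_pos (by lia), if_pos (by lia),
      show r + k - r = k by lia, show r + k + 1 - r = k + 1 by lia,
      show r + k + 1 + r = r + k + r + 1 by lia, qPoch_succ, qPoch_succ]
    field_simp

lemma baileyKernel_shift (hq : ∀ n, 1 - q ^ (n + 1) ≠ 0) {n r : ℕ} (h : r ≤ n) :
    (1 - q ^ (n + 1 - r)) * baileyKernel q (n + 1) r =
      (1 - q ^ (n + 2 + r)) * baileyKernel q (n + 1) (r + 1) := by
  obtain ⟨k, rfl⟩ := Nat.exists_eq_add_of_le h
  have h1 := hq k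
  have h2 := hq (r + k + 1 + r)
  have h3 := qPoch_ne_zero hq k
  have h4 := qPoch_ne_zero hq (r + k + 1 + r)
  rw [baileyKernel, baileyKernel, if_pos (by lia), if_pos (by lia),
    show r + k + 1 - r = k + 1 by lia, show r + k + 1 - (r + 1) = k by lia,
    show r + k + 1 + (r + 1) = r + k + 1 + r + 1 by lia,
    show r + k + 2 + r = r + k + 1 + r + 1 by lia, qPoch_succ, qPoch_succ]
  field_simp

/-- The nonconstant terms `(-1)^r q^(r(3r-1)/2) (1 + q^r)` of the Bailey pair whose other
member is `1 / (q)_n`. -/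
def baileyAlpha {R : Type*} [CommRing R] (q : R) (r : ℕ) : R :=
  (-1) ^ r * q ^ (r * (3 * r - 1) / 2) * (1 + q ^ r)

lemma mul_three_mul_sub_one_half_succ (r : ℕ) :
    (r + 1) * (3 * (r + 1) - 1) / 2 = 3 * (r * (r + 1) / 2) + r + 1 := by
  obtain ⟨m, hm⟩ := Nat.even_mul_succ_self r
  have h : (r + 1) * (3 * (r + 1) - 1) = 2 * (3 * m + r + 1) := by
    rw [show 3 * (r + 1) - 1 = 3 * r + 2 by lia]
    nlinarith
  rw [h, hm]
  lia

lemma succ_mul_succ_half (r : ℕ) : (r + 1) * (r + 2) / 2 = r * (r + 1) / 2 + r + 1 := by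
  obtain ⟨m, hm⟩ := Nat.even_mul_succ_self r
  have h : (r + 1) * (r + 2) = 2 * (m + r + 1) := by nlinarith
  rw [h, hm]
  lia

lemma baileyAlpha_telescope (hq : ∀ n, 1 - q ^ (n + 1) ≠ 0) {n r : ℕ} (h : r ≤ n) :
    qPoch q (n + 1) * (baileyAlpha q (r + 1) * baileyKernel q (n + 1) (r + 1)) -
        qPoch q n * (baileyAlpha q (r + 1) * baileyKernel q n (r + 1)) =
      (-1) ^ (r + 1) * q ^ (n + 1 + 3 * ((r + 1) * (r + 2) / 2)) * qPoch q n *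
          ((1 - q ^ (n + 1 - (r + 1))) * baileyKernel q (n + 1) (r + 1)) -
        (-1) ^ r * q ^ (n + 1 + 3 * (r * (r + 1) / 2)) * qPoch q n *
          ((1 - q ^ (n + 1 - r)) * baileyKernel q (n + 1) r) := by
  rw [baileyKernel_shift hq h, baileyKernel_succ_left hq (n := n) (r := r + 1) (by lia), baileyAlpha,
    mul_three_mul_sub_one_half_succ, succ_mul_succ_half, qPoch_succ]
  obtain ⟨k, rfl⟩ := Nat.exists_eq_add_of_le h
  rw [show r + k + 1 - (r + 1) = k by lia]
  ring

/-- The Bailey pair relative to `1` with `β_n = 1 / (q)_n`. -/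
theorem sum_baileyAlpha_mul_baileyKernel (hq : ∀ n, 1 - q ^ (n + 1) ≠ 0) (n : ℕ) :
    (qPoch q n ^ 2)⁻¹ + ∑ r ∈ range n, baileyAlpha q (r + 1) * baileyKernel q n (r + 1) =
      (qPoch q n)⁻¹ := by
  suffices h : (qPoch q n)⁻¹ +
      ∑ r ∈ range n, qPoch q n * (baileyAlpha q (r + 1) * baileyKernel q n (r + 1)) = 1 by
    have h0 := qPoch_ne_zero hq n
    rw [← mul_sum] at h
    apply mul_left_cancel₀ h0
    rw [mul_add, mul_inv_cancel₀ h0, ← h]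
    field_simp
  induction n with
  | zero => simp
  | succ n ih =>
    have h1 := sum_congr rfl fun r (hr : r ∈ range (n + 1)) =>
      baileyAlpha_telescope hq (Nat.lt_succ_iff.1 (mem_range.1 hr))
    rw [sum_range_sub fun r => (-1) ^ r * q ^ (n + 1 + 3 * (r * (r + 1) / 2)) * qPoch q n *
      ((1 - q ^ (n + 1 - r)) * baileyKernel q (n + 1) r), sum_sub_distrib,
      sum_range_succ (fun r => qPoch q n * (baileyAlpha q (r + 1) * baileyKernel q n (r + 1))),
      show baileyKernel q n (n + 1) = 0 by simp [baileyKernel], baileyKernel_zero_right] at h1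
    have h2 := qPoch_ne_zero hq n
    have h3 := hq n
    have h4 : (qPoch q (n + 1))⁻¹ + q ^ (n + 1) * qPoch q n *
        ((1 - q ^ (n + 1)) * (qPoch q (n + 1) ^ 2)⁻¹) * (-1) = (qPoch q n)⁻¹ := by
      rw [qPoch_succ]
      field_simp
      ring
    simp at h1
    linear_combination h1 + ih + h4

/-- The summation formula for the conjugate Bailey pair, in difference form. -/
lemma baileyKernel_conjugate (hq : ∀ n, 1 - q ^ (n + 1) ≠ 0) {n r : ℕ} (h : r ≤ n) :
    q ^ (r + 1) / (1 - q ^ (r + 1)) ^ 2 *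
        (qPoch q (n + 1) ^ 2 * baileyKernel q (n + 1) (r + 1)) -
      q ^ (r + 1) / (1 - q ^ (r + 1)) ^ 2 * (qPoch q n ^ 2 * baileyKernel q n (r + 1)) =
    qPoch q n ^ 2 * q ^ (n + 1) * baileyKernel q (n + 1) (r + 1) := by
  have h1 := hq r
  rw [baileyKernel_succ_left hq (n := n) (r := r + 1) (by lia), qPoch_succ]
  obtain ⟨k, rfl⟩ := Nat.exists_eq_add_of_le h
  rw [show r + k + 1 - (r + 1) = k by lia]
  field_simp
  ring

theorem sum_qPoch_mul_pow_div (hq : ∀ n, 1 - q ^ (n + 1) ≠ 0) (N : ℕ) :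
    ∑ n ∈ range N, qPoch q n * (q ^ (n + 1) / (1 - q ^ (n + 1))) =
      ∑ n ∈ range N, q ^ (n + 1) / (1 - q ^ (n + 1)) ^ 2 +
      ∑ r ∈ range N, baileyAlpha q (r + 1) * (q ^ (r + 1) / (1 - q ^ (r + 1)) ^ 2 *
        (qPoch q N ^ 2 * baileyKernel q N (r + 1))) := by
  induction N with
  | zero => simp
  | succ N ih =>
    have h1 := sum_congr rfl fun r (hr : r ∈ range (N + 1)) =>
      congrArg (baileyAlpha q (r + 1) * ·)
        (baileyKernel_conjugate hq (Nat.lt_succ_iff.1 (mem_range.1 hr)))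
    simp only [mul_sub] at h1
    rw [sum_sub_distrib, sum_range_succ (fun r => baileyAlpha q (r + 1) *
      (q ^ (r + 1) / (1 - q ^ (r + 1)) ^ 2 * (qPoch q N ^ 2 * baileyKernel q N (r + 1)))),
      show baileyKernel q N (N + 1) = 0 by simp [baileyKernel]] at h1
    have h2 : ∑ r ∈ range (N + 1), baileyAlpha q (r + 1) *
        (qPoch q N ^ 2 * q ^ (N + 1) * baileyKernel q (N + 1) (r + 1)) =
        qPoch q N ^ 2 * q ^ (N + 1) * ((qPoch q (N + 1))⁻¹ - (qPoch q (N + 1) ^ 2)⁻¹) := by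
      rw [← sum_baileyAlpha_mul_baileyKernel hq (N + 1), add_sub_cancel_left, mul_sum]
      exact sum_congr rfl fun _ _ => by ring
    have h3 := qPoch_ne_zero hq N
    have h4 := hq N
    have h5 : qPoch q N ^ 2 * q ^ (N + 1) * ((qPoch q (N + 1))⁻¹ - (qPoch q (N + 1) ^ 2)⁻¹) =
        qPoch q N * (q ^ (N + 1) / (1 - q ^ (N + 1))) -
          q ^ (N + 1) / (1 - q ^ (N + 1)) ^ 2 := by
      rw [qPoch_succ]
      field_simp
    rw [sum_range_succ, sum_range_succ (fun n => q ^ (n + 1) / (1 - q ^ (n + 1)) ^ 2), ih]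
    linear_combination -h1 - h2 - h5

end BaileyPair

section DivisorSums

lemma chi12_sq_sub_sq {a b : ℕ} (h : a < b) (h3 : 3 ∣ a * b) :
    chi12 (b ^ 2 - a ^ 2) =
      if 3 ∣ a ∧ 3 ∣ b ∨ a % 2 = b % 2 then 0
      else if 6 ∣ a ∨ 6 ∣ b then 1 else -1 := by
  have key : ∀ x < 12, ∀ y < 12, (x * y) % 3 = 0 → ∀ m < 12, (m + x ^ 2) % 12 = y ^ 2 % 12 →
      chi12 m = if x % 3 = 0 ∧ y % 3 = 0 ∨ x % 2 = y % 2 then 0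
      else if x % 6 = 0 ∨ y % 6 = 0 then 1 else -1 := by decide
  have hm : (((b ^ 2 - a ^ 2) % 12) + (a % 12) ^ 2) % 12 = (b % 12) ^ 2 % 12 := by
    have := Nat.pow_le_pow_left h.le 2
    conv_rhs => rw [← Nat.pow_mod, ← Nat.sub_add_cancel this]
    simp [Nat.add_mod, Nat.pow_mod]
  have h3' : (a % 12 * (b % 12)) % 3 = 0 := by
    have := Nat.mod_eq_zero_of_dvd h3
    rw [Nat.mul_mod] at this ⊢
    rwa [Nat.mod_mod_of_dvd _ (by norm_num), Nat.mod_mod_of_dvd _ (by norm_num)]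
  have := key (a % 12) (Nat.mod_lt _ (by norm_num)) (b % 12) (Nat.mod_lt _ (by norm_num)) h3'
    _ (Nat.mod_lt _ (by norm_num)) hm
  rw [show chi12 (b ^ 2 - a ^ 2) = chi12 ((b ^ 2 - a ^ 2) % 12) by simp [chi12], this]
  simp only [Nat.dvd_iff_mod_eq_zero]
  rw [Nat.mod_mod_of_dvd a (by norm_num : 3 ∣ 12), Nat.mod_mod_of_dvd b (by norm_num : 3 ∣ 12),
    Nat.mod_mod_of_dvd a (by norm_num : 2 ∣ 12), Nat.mod_mod_of_dvd b (by norm_num : 2 ∣ 12),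
    Nat.mod_mod_of_dvd a (by norm_num : 6 ∣ 12), Nat.mod_mod_of_dvd b (by norm_num : 6 ∣ 12)]

/-- `σ(n)` plus the sum of the odd divisors of `n` is twice the sum of the divisors with odd
codivisor. -/
lemma sum_divisors_add_sum_odd {n : ℕ} (hn : n ≠ 0) :
    ∑ d ∈ n.divisors, d + ∑ d ∈ n.divisors with Odd d, d =
      2 * ∑ d ∈ n.divisors with Odd (n / d), d := by
  obtain ⟨k, m, hm, rfl⟩ := Nat.exists_eq_two_pow_mul_odd hn
  have hcop : Nat.Coprime (2 ^ k) m := (Nat.coprime_two_left.2 hm).pow_left k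
  have hsigma : ∑ d ∈ (2 ^ k * m).divisors, d =
      (∑ i ∈ range (k + 1), 2 ^ i) * ∑ d ∈ m.divisors, d := by
    rw [hcop.sum_divisors_mul, Nat.sum_divisors_prime_pow Nat.prime_two]
  have hodd : ((2 ^ k * m).divisors.filter fun d => Odd d) = m.divisors := by
    ext d
    simp only [mem_filter, Nat.mem_divisors]
    constructor
    · rintro ⟨⟨h, -⟩, hd⟩
      exact ⟨((Nat.coprime_two_right.2 hd).pow_right k).dvd_of_dvd_mul_left h, hm.pos.ne'⟩
    · rintro ⟨h, -⟩
      exact ⟨⟨h.mul_left _, hn⟩, hm.of_dvd_nat h⟩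
  have hcod : ∑ d ∈ (2 ^ k * m).divisors with Odd (2 ^ k * m / d), d =
      2 ^ k * ∑ d ∈ m.divisors, d := by
    rw [mul_sum]
    refine (sum_bij (fun d _ => 2 ^ k * d) ?_ ?_ ?_ ?_).symm
    · intro d hd
      rw [Nat.mem_divisors] at hd
      simp only [mem_filter, Nat.mem_divisors]
      refine ⟨⟨mul_dvd_mul_left _ hd.1, hn⟩, ?_⟩
      rw [Nat.mul_div_mul_left _ _ (by positivity)]
      exact hm.of_dvd_nat (Nat.div_dvd_of_dvd hd.1)
    · intro a _ b _ h
      exact Nat.eq_of_mul_eq_mul_left (by positivity) h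
    · intro d hd
      simp only [mem_filter, Nat.mem_divisors] at hd
      obtain ⟨⟨⟨c, hc⟩, -⟩, h⟩ := hd
      have hd0 : 0 < d := Nat.pos_of_ne_zero (by rintro rfl; simp at hc; lia)
      rw [hc, Nat.mul_div_cancel_left _ hd0] at h
      have : 2 ^ k ∣ d :=
        ((Nat.coprime_two_left.2 h).pow_left k).dvd_of_dvd_mul_right ⟨m, hc.symm⟩
      obtain ⟨e, rfl⟩ := this
      refine ⟨e, Nat.mem_divisors.2 ⟨⟨c, ?_⟩, hm.pos.ne'⟩, rfl⟩
      rw [mul_assoc] at hc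
      exact Nat.eq_of_mul_eq_mul_left (by positivity) hc
    · intros; rfl
  have hgeom : ∑ i ∈ range (k + 1), 2 ^ i + 1 = 2 * 2 ^ k := by
    have := Nat.geomSum_eq (le_refl 2) (k + 1)
    rw [this, pow_succ]
    have : 0 < 2 ^ k := by positivity
    lia
  rw [hsigma, hodd, hcod]
  linear_combination (∑ d ∈ m.divisors, d) * hgeom

/-- The pairs `(e, o)` with `e * o = 6 * n`, `e` even, `o` odd and `3 ∣ e`, summed over `o`. -/
lemma sum_divisorsAntidiagonal_odd_snd {n : ℕ} (hn : n ≠ 0) :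
    ∑ x ∈ (6 * n).divisorsAntidiagonal with Even x.1 ∧ Odd x.2 ∧ 3 ∣ x.1, x.2 =
      ∑ d ∈ n.divisors with Odd d, d := by
  refine (sum_bij (fun d _ => (6 * n / d, d)) ?_ ?_ ?_ ?_).symm
  · intro d hd
    simp only [mem_filter, Nat.mem_divisors] at hd
    obtain ⟨⟨⟨c, rfl⟩, -⟩, h⟩ := hd
    have hd0 := h.pos
    rw [show 6 * (d * c) = 6 * c * d by ring, Nat.mul_div_cancel _ hd0]
    simp only [mem_filter, Nat.mem_divisorsAntidiagonal]
    refine ⟨⟨trivial, by lia⟩, ⟨3 * c, by ring⟩, h, 2 * c, by ring⟩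
  · intro a _ b _ h
    exact (Prod.ext_iff.1 h).2
  · rintro ⟨e, o⟩ h
    simp only [mem_filter, Nat.mem_divisorsAntidiagonal] at h
    obtain ⟨⟨h, h0⟩, he, ho, h3⟩ := h
    obtain ⟨c, rfl⟩ : 6 ∣ e := by have := he.two_dvd; lia
    refine ⟨o, ?_, ?_⟩
    · simp only [mem_filter, Nat.mem_divisors]
      exact ⟨⟨⟨c, by nlinarith⟩, hn⟩, ho⟩
    · rw [← h, Nat.mul_div_cancel _ ho.pos]
  · intros; rfl

/-- The pairs `(e, o)` with `e * o = 6 * n`, `e` even, `o` odd and `3 ∣ o`, summed over `e`. -/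
lemma sum_divisorsAntidiagonal_even_fst {n : ℕ} (hn : n ≠ 0) :
    ∑ x ∈ (6 * n).divisorsAntidiagonal with Even x.1 ∧ Odd x.2 ∧ 3 ∣ x.2, x.1 =
      2 * ∑ d ∈ n.divisors with Odd (n / d), d := by
  rw [mul_sum]
  refine (sum_bij (fun d _ => (2 * d, 3 * (n / d))) ?_ ?_ ?_ ?_).symm
  · intro d hd
    simp only [mem_filter, Nat.mem_divisors] at hd
    obtain ⟨⟨hd, -⟩, h⟩ := hd
    simp only [mem_filter, Nat.mem_divisorsAntidiagonal]
    refine ⟨⟨?_, by lia⟩, even_two_mul d, (by decide : Odd 3).mul h, _, rfl⟩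
    nlinarith [Nat.mul_div_cancel' hd]
  · intro a _ b _ h
    have := (Prod.ext_iff.1 h).1
    simpa using this
  · rintro ⟨e, o⟩ h
    simp only [mem_filter, Nat.mem_divisorsAntidiagonal] at h
    obtain ⟨⟨h, h0⟩, he, ho, ⟨c, rfl⟩⟩ := h
    obtain ⟨d, rfl⟩ := he.two_dvd
    have hn' : n = d * c := by nlinarith
    have hd : 0 < d := Nat.pos_of_ne_zero (by rintro rfl; simp at hn'; exact hn hn')
    have hc : n / d = c := by rw [hn', Nat.mul_div_cancel_left _ hd]
    refine ⟨d, ?_, ?_⟩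
    · simp only [mem_filter, Nat.mem_divisors, hc]
      exact ⟨⟨⟨c, hn'⟩, hn⟩, (Nat.odd_mul.1 ho).2⟩
    · rw [hc]
  · intros; rfl

/-- The signed gap `±(b - a)` attached to a factorization `a * b` with `a < b`, `3 ∣ a` and
`a`, `b` of opposite parity. -/
def signedGap (a b : ℕ) : ℤ :=
  if a < b ∧ 3 ∣ a ∧ a % 2 ≠ b % 2 then (-1) ^ a * ((b : ℤ) - a) else 0

lemma signedGap_add_chi12_symm {a b : ℕ} (h3 : 3 ∣ a * b) :
    (signedGap a b + if a < b then chi12 (b ^ 2 - a ^ 2) * a else 0) +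
      (signedGap b a + if b < a then chi12 (a ^ 2 - b ^ 2) * b else 0) =
    (((if Even a ∧ Odd b ∧ 3 ∣ a then (b : ℤ) else 0) -
        if Even a ∧ Odd b ∧ 3 ∣ b then (a : ℤ) else 0) +
      ((if Even b ∧ Odd a ∧ 3 ∣ b then (a : ℤ) else 0) -
        if Even b ∧ Odd a ∧ 3 ∣ a then (b : ℤ) else 0)) := by
  wlog h : a < b generalizing a b
  · rcases (not_lt.1 h).eq_or_lt with rfl | h
    · simp only [signedGap, lt_irrefl, Nat.even_iff, Nat.odd_iff]
      grind
    · have := this (mul_comm a b ▸ h3) h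
      linear_combination this
  have h3' := (Nat.Prime.dvd_mul Nat.prime_three).1 h3
  rw [if_pos h, if_neg h.not_gt, chi12_sq_sub_sq h h3]
  simp only [signedGap, h, h.not_gt, true_and, false_and, if_false, Nat.even_iff, Nat.odd_iff]
  rcases Nat.mod_two_eq_zero_or_one a with ha | ha
  · rw [(Nat.even_iff.2 ha).neg_one_pow]
    rcases Nat.mod_two_eq_zero_or_one b with hb | hb <;>
    by_cases ha3 : 3 ∣ a <;> by_cases hb3 : 3 ∣ b <;>
    simp [ha, hb, ha3, hb3] <;> grind
  · rw [(Nat.odd_iff.2 ha).neg_one_pow]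
    rcases Nat.mod_two_eq_zero_or_one b with hb | hb <;>
    by_cases ha3 : 3 ∣ a <;> by_cases hb3 : 3 ∣ b <;>
    simp [ha, hb, ha3, hb3] <;> grind

theorem sum_divisors_add_sum_signedGap {n : ℕ} (hn : n ≠ 0) :
    ((∑ d ∈ n.divisors, d : ℕ) : ℤ) +
      ∑ x ∈ (6 * n).divisorsAntidiagonal, signedGap x.1 x.2 = sptRHS n := by
  have hswap : ∀ f : ℕ → ℕ → ℤ, ∑ x ∈ (6 * n).divisorsAntidiagonal, f x.2 x.1 =
      ∑ x ∈ (6 * n).divisorsAntidiagonal, f x.1 x.2 := fun f => by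
    conv_rhs => rw [← Nat.map_swap_divisorsAntidiagonal, sum_map]
    rfl
  have hR : sptRHS n = -∑ x ∈ (6 * n).divisorsAntidiagonal,
      if x.1 < x.2 then chi12 (x.2 ^ 2 - x.1 ^ 2) * (x.1 : ℤ) else 0 := by
    rw [sptRHS, sum_filter, Nat.sum_divisorsAntidiagonal
      fun a b : ℕ => if a < b then chi12 (b ^ 2 - a ^ 2) * (a : ℤ) else 0]
  have hpair := sum_congr rfl fun x (hx : x ∈ (6 * n).divisorsAntidiagonal) =>
    signedGap_add_chi12_symm (a := x.1) (b := x.2) (by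
      rw [(Nat.mem_divisorsAntidiagonal.1 hx).1]; exact ⟨2 * n, by ring⟩)
  simp only [sum_add_distrib, sum_sub_distrib] at hpair
  have h1 := congrArg (Nat.cast : ℕ → ℤ) (sum_divisorsAntidiagonal_odd_snd hn)
  have h2 := congrArg (Nat.cast : ℕ → ℤ) (sum_divisorsAntidiagonal_even_fst hn)
  have h3 := congrArg (Nat.cast : ℕ → ℤ) (sum_divisors_add_sum_odd hn)
  rw [hswap signedGap,
    hswap fun a b => if a < b then chi12 (b ^ 2 - a ^ 2) * (a : ℤ) else 0,
    hswap fun a b => if Even a ∧ Odd b ∧ 3 ∣ a then (b : ℤ) else 0,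
    hswap fun a b => if Even a ∧ Odd b ∧ 3 ∣ b then (a : ℤ) else 0] at hpair
  simp only [sum_filter] at h1 h2 h3
  rw [hR]
  push_cast at *
  linarith

end DivisorSums

section LambertSeries

open PowerSeries

/-- The geometric series `1 / (1 - X ^ n)`. -/
def geomSeries (n : ℕ) : ℤ⟦X⟧ := PowerSeries.mk fun k => if n ∣ k then 1 else 0

/-- The Lambert series `X ^ n / (1 - X ^ n) ^ 2`. -/
def lambertSeries (n : ℕ) : ℤ⟦X⟧ :=
  PowerSeries.mk fun k => if n ∣ k then ((k / n : ℕ) : ℤ) else 0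

lemma geomSeries_mul_one_sub {n : ℕ} (hn : 0 < n) : geomSeries n * (1 - X ^ n) = 1 := by
  ext k
  rw [mul_sub, mul_one, map_sub, coeff_mul_X_pow', coeff_one]
  simp only [geomSeries, coeff_mk]
  rcases lt_or_ge k n with h | h
  · rw [if_neg h.not_ge, sub_zero]
    exact if_congr ⟨fun h' => Nat.eq_zero_of_dvd_of_lt h' h, fun h' => h' ▸ dvd_zero n⟩ rfl rfl
  · rw [if_pos h, if_neg (by lia : ¬k = 0)]
    simp [Nat.dvd_sub_iff_left h dvd_rfl]

lemma lambertSeries_mul_one_sub {n : ℕ} (hn : 0 < n) :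
    lambertSeries n * (1 - X ^ n) = X ^ n * geomSeries n := by
  ext k
  rw [mul_sub, mul_one, map_sub, coeff_mul_X_pow', coeff_X_pow_mul']
  simp only [geomSeries, lambertSeries, coeff_mk]
  rcases lt_or_ge k n with h | h
  · simp [h.not_ge, Nat.div_eq_of_lt h]
  · obtain ⟨m, rfl⟩ := Nat.exists_eq_add_of_le h
    simp only [h, if_true, Nat.add_sub_cancel_left, Nat.dvd_add_right dvd_rfl, Nat.add_div_left m hn]
    split_ifs <;> simp

lemma lambertSeries_eq {n : ℕ} (hn : 0 < n) : lambertSeries n = X ^ n * geomSeries n ^ 2 := by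
  have h1 := geomSeries_mul_one_sub hn
  have h2 := lambertSeries_mul_one_sub hn
  linear_combination geomSeries n * h2 - lambertSeries n * h1

lemma dvd_prod_sub_one {ι R : Type*} [CommRing R] {d : R} {s : Finset ι} {f : ι → R}
    (h : ∀ i ∈ s, d ∣ f i - 1) : d ∣ ∏ i ∈ s, f i - 1 := by
  classical
  induction s using Finset.induction_on with
  | empty => simp
  | insert a s ha ih =>
    rw [prod_insert ha, show f a * ∏ i ∈ s, f i - 1 =
      f a * (∏ i ∈ s, f i - 1) + (f a - 1) by ring]
    exact dvd_add ((ih fun i hi => h i (mem_insert_of_mem hi)).mul_left _)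
      (h a (mem_insert_self a s))

/-- The series `(X)_N ^ 2 / ((X)_{N-r} (X)_{N+r})`, for `r ≤ N`. -/
noncomputable def qPochRatio (N r : ℕ) : ℤ⟦X⟧ :=
  (∏ i ∈ range r, (1 - X ^ (N - r + i + 1))) * ∏ i ∈ range r, geomSeries (N + i + 1)

lemma X_pow_dvd_qPochRatio_sub_one (N r : ℕ) :
    (X : ℤ⟦X⟧) ^ (N - r + 1) ∣ qPochRatio N r - 1 := by
  have h1 : (X : ℤ⟦X⟧) ^ (N - r + 1) ∣ ∏ i ∈ range r, (1 - X ^ (N - r + i + 1)) - 1 :=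
    dvd_prod_sub_one fun i _ => by
      rw [sub_sub_cancel_left, dvd_neg]
      exact pow_dvd_pow _ (by lia)
  have h2 : (X : ℤ⟦X⟧) ^ (N - r + 1) ∣ ∏ i ∈ range r, geomSeries (N + i + 1) - 1 :=
    dvd_prod_sub_one fun i _ => by
      rw [show geomSeries (N + i + 1) - 1 = X ^ (N + i + 1) * geomSeries (N + i + 1) by
        linear_combination geomSeries_mul_one_sub (n := N + i + 1) (by lia)]
      exact (pow_dvd_pow _ (by lia)).mul_right _
  rw [qPochRatio]
  set A := ∏ i ∈ range r, (1 - (X : ℤ⟦X⟧) ^ (N - r + i + 1))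
  set B := ∏ i ∈ range r, geomSeries (N + i + 1)
  rw [show A * B - 1 = A * (B - 1) + (A - 1) by ring]
  exact dvd_add (h2.mul_left _) h1

lemma map_qPoch {R S : Type*} [CommRing R] [CommRing S] (f : R →+* S) (q : R) (n : ℕ) :
    f (qPoch q n) = qPoch (f q) n := by
  simp [qPoch]

theorem sum_qPoch_mul_geomSeries (N : ℕ) :
    ∑ n ∈ range N, qPoch (X : ℤ⟦X⟧) n * (X ^ (n + 1) * geomSeries (n + 1)) =
      ∑ n ∈ range N, lambertSeries (n + 1) +
      ∑ r ∈ range N, baileyAlpha (X : ℤ⟦X⟧) (r + 1) *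
        (lambertSeries (r + 1) * qPochRatio N (r + 1)) := by
  let f := algebraMap ℤ⟦X⟧ (FractionRing ℤ⟦X⟧)
  have hf : Function.Injective f := IsFractionRing.injective _ _
  have hgeom (n : ℕ) : f (geomSeries (n + 1)) * (1 - f X ^ (n + 1)) = 1 := by
    simpa using congrArg f (geomSeries_mul_one_sub (Nat.succ_pos n))
  have hq (n : ℕ) : 1 - f X ^ (n + 1) ≠ 0 := right_ne_zero_of_mul_eq_one (hgeom n)
  have hgeom' (n : ℕ) : f (geomSeries (n + 1)) = (1 - f X ^ (n + 1))⁻¹ :=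
    eq_inv_of_mul_eq_one_left (hgeom n)
  have hlambert (n : ℕ) :
      f (lambertSeries (n + 1)) = f X ^ (n + 1) / (1 - f X ^ (n + 1)) ^ 2 := by
    rw [lambertSeries_eq (Nat.succ_pos n), map_mul, map_pow, map_pow, hgeom', inv_pow,
      div_eq_mul_inv]
  have hratio {r : ℕ} (hr : r ≤ N) :
      f (qPochRatio N r) = qPoch (f X) N ^ 2 * baileyKernel (f X) N r := by
    have h1 : qPoch (f X) N =
        qPoch (f X) (N - r) * ∏ i ∈ range r, (1 - f X ^ (N - r + i + 1)) := by
      conv_lhs => rw [← Nat.sub_add_cancel hr, qPoch, prod_range_add]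
      rfl
    have h2 : qPoch (f X) (N + r) =
        qPoch (f X) N * ∏ i ∈ range r, (1 - f X ^ (N + i + 1)) := by
      rw [qPoch, prod_range_add]
      rfl
    have h3 := qPoch_ne_zero hq (N - r)
    have h4 := qPoch_ne_zero hq N
    have h5 : ∏ i ∈ range r, (1 - f X ^ (N + i + 1)) ≠ 0 := prod_ne_zero_iff.2 fun i _ => hq _
    simp only [qPochRatio, map_mul, map_prod, hgeom', map_sub, map_one, map_pow, prod_inv_distrib]
    rw [baileyKernel, if_pos hr, h2]
    field_simp
    rw [mul_comm, h1]
  apply hf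
  have h := sum_qPoch_mul_pow_div hq N
  simp only [map_add, map_sum, map_mul, hlambert, map_qPoch, hgeom', map_pow, ← div_eq_mul_inv]
  rw [h]
  congr 1
  refine sum_congr rfl fun r hr => ?_
  rw [hratio (mem_range.1 hr)]
  simp [baileyAlpha]

theorem coeff_sum_qPoch_mul_geomSeries (N : ℕ) :
    coeff N (∑ n ∈ range N, qPoch (X : ℤ⟦X⟧) n * (X ^ (n + 1) * geomSeries (n + 1))) =
      ∑ n ∈ range N, coeff N (lambertSeries (n + 1)) +
      ∑ r ∈ range N, coeff N (baileyAlpha (X : ℤ⟦X⟧) (r + 1) * lambertSeries (r + 1)) := by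
  rw [sum_qPoch_mul_geomSeries, map_add, map_sum, map_sum]
  congr 1
  refine sum_congr rfl fun r hr => ?_
  rw [← sub_eq_zero, ← map_sub]
  refine X_pow_dvd_iff.1 ?_ N (Nat.lt_succ_self N)
  rw [← mul_sub, ← mul_sub_one, lambertSeries_eq (Nat.succ_pos r)]
  refine Dvd.dvd.mul_left ?_ _
  have h := mul_dvd_mul (dvd_mul_right ((X : ℤ⟦X⟧) ^ (r + 1)) (geomSeries (r + 1) ^ 2))
    (X_pow_dvd_qPochRatio_sub_one N (r + 1))
  rwa [← pow_add, show r + 1 + (N - (r + 1) + 1) = N + 1 by have := mem_range.1 hr; lia] at h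

lemma sum_coeff_lambertSeries (N : ℕ) :
    ∑ n ∈ range N, coeff N (lambertSeries (n + 1)) = ((∑ d ∈ N.divisors, d : ℕ) : ℤ) := by
  rw [Nat.cast_sum, ← Nat.sum_div_divisors N fun d => (d : ℤ)]
  have h : N.divisors = (Ico 1 (N + 1)).filter (· ∣ N) := rfl
  rw [h, sum_filter, range_eq_Ico,
    ← sum_Ico_add' (fun d => if d ∣ N then ((N / d : ℕ) : ℤ) else 0) 0 N 1]
  simp [lambertSeries]

lemma two_mul_half_add_self (r : ℕ) : 2 * (r * (3 * r - 1) / 2) + r = 3 * (r * r) := by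
  rcases r with _ | r
  · rfl
  · obtain ⟨m, hm⟩ := Nat.even_mul_succ_self r
    have : r * (r + 1) / 2 = m := by lia
    rw [mul_three_mul_sub_one_half_succ, this]
    nlinarith

lemma coeff_baileyAlpha_mul_lambertSeries {N r : ℕ} (hr : 0 < r) :
    coeff N (baileyAlpha (X : ℤ⟦X⟧) r * lambertSeries r) =
      if r ∣ 2 * N then signedGap (3 * r) (2 * N / r) else 0 := by
  have he := two_mul_half_add_self r
  rw [baileyAlpha]
  generalize r * (3 * r - 1) / 2 = e at he
  have hC : (-1 : ℤ⟦X⟧) ^ r = C ((-1) ^ r) := by simp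
  rw [hC, show C ((-1 : ℤ) ^ r) * X ^ e * (1 + X ^ r) * lambertSeries r =
    C ((-1 : ℤ) ^ r) * (X ^ e * (lambertSeries r + X ^ r * lambertSeries r)) by ring,
    coeff_C_mul, coeff_X_pow_mul', map_add, coeff_X_pow_mul']
  simp only [lambertSeries, coeff_mk]
  by_cases h2 : r ∣ 2 * N
  · obtain ⟨b, hb⟩ := h2
    rw [hb, if_pos (dvd_mul_right r b), Nat.mul_div_cancel_left _ hr]
    rcases lt_or_ge N e with h | h
    · rw [if_neg h.not_ge, signedGap, if_neg, mul_zero]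
      rintro ⟨h1, -⟩
      nlinarith
    · rw [if_pos h]
      obtain ⟨M, rfl⟩ := Nat.exists_eq_add_of_le h
      rw [Nat.add_sub_cancel_left]
      by_cases hM : r ∣ M
      · obtain ⟨m, rfl⟩ := hM
        have hb' : b + 1 = 3 * r + 2 * m := by
          apply Nat.eq_of_mul_eq_mul_left hr
          nlinarith
        rcases m with _ | m
        · have hs : signedGap (3 * r) b = 0 := if_neg (by lia)
          simp [hs]
        · have h3 : r ≤ r * (m + 1) := Nat.le_mul_of_pos_right r m.succ_pos
          have h4 : r * (m + 1) - r = r * m := by rw [mul_add_one, Nat.add_sub_cancel]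
          have hs : signedGap (3 * r) b = (-1) ^ (3 * r) * ((b : ℤ) - (3 * r : ℕ)) :=
            if_pos ⟨by lia, dvd_mul_right _ _, by lia⟩
          rw [hs, if_pos h3, h4, if_pos (dvd_mul_right _ _), if_pos (dvd_mul_right _ _),
            Nat.mul_div_cancel_left _ hr, Nat.mul_div_cancel_left _ hr, pow_mul]
          have : (b : ℤ) = 3 * r + 2 * m + 1 := by lia
          rw [this]
          push_cast
          ring
      · have h3 : ¬ (r ≤ M ∧ r ∣ M - r) := fun h' =>
          hM (by simpa [Nat.sub_add_cancel h'.1] using h'.2.add (dvd_refl r))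
        rw [signedGap, if_neg hM, ← ite_and, if_neg h3, add_zero, mul_zero, if_neg]
        rintro ⟨-, -, h5⟩
        obtain ⟨t, ht⟩ : ∃ t, 3 * r + 2 * t = b + 1 ∨ 3 * r = b + 1 + 2 * t := by
          rcases le_total (3 * r) (b + 1) with h6 | h6
          · exact ⟨(b + 1 - 3 * r) / 2, by lia⟩
          · exact ⟨(3 * r - (b + 1)) / 2, by lia⟩
        apply hM
        rcases ht with ht | ht
        · exact ⟨t, by nlinarith⟩
        · have : M + r * t = 0 := by nlinarith
          exact ⟨0, by lia⟩
  · have h3 : ¬ r ∣ N - e ∨ ¬ e ≤ N := by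
      by_contra! h
      obtain ⟨⟨m, hm⟩, h⟩ := h
      obtain ⟨M, rfl⟩ := Nat.exists_eq_add_of_le h
      rw [Nat.add_sub_cancel_left] at hm
      subst hm
      apply h2
      have : r * (3 * r + 2 * m) = 2 * (e + r * m) + r := by nlinarith
      exact (Nat.dvd_add_left dvd_rfl).1 ⟨_, this.symm⟩
    rw [if_neg h2]
    split_ifs with h4 h5 h6 h7 <;> simp_all

lemma sum_coeff_baileyAlpha_mul_lambertSeries {N : ℕ} (hN : N ≠ 0) :
    ∑ r ∈ range N, coeff N (baileyAlpha (X : ℤ⟦X⟧) (r + 1) * lambertSeries (r + 1)) =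
      ∑ x ∈ (6 * N).divisorsAntidiagonal, signedGap x.1 x.2 := by
  simp only [coeff_baileyAlpha_mul_lambertSeries (Nat.succ_pos _)]
  rw [Nat.sum_divisorsAntidiagonal signedGap, range_eq_Ico,
    sum_Ico_add' (fun r => if r ∣ 2 * N then signedGap (3 * r) (2 * N / r) else 0) 0 N 1,
    ← sum_filter]
  have hdiv {r : ℕ} : 6 * N / (3 * r) = 2 * N / r := by
    rw [show 6 * N = 3 * (2 * N) by ring, Nat.mul_div_mul_left _ _ (by norm_num)]
  refine sum_of_injOn (3 * ·) ?_ ?_ ?_ ?_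
  · intro a _ b _ h
    simpa using h
  · intro r hr
    simp only [coe_filter, Set.mem_ofPred_eq] at hr
    simp only [mem_coe, Nat.mem_divisors]
    refine ⟨?_, by lia⟩
    rw [show 6 * N = 3 * (2 * N) by ring]
    exact mul_dvd_mul_left _ hr.2
  · intro a ha h
    rw [signedGap, if_neg]
    rintro ⟨h1, ⟨r, rfl⟩, -⟩
    apply h
    rw [Nat.mem_divisors, show 6 * N = 3 * (2 * N) by ring] at ha
    have h2 : r ∣ 2 * N := Nat.dvd_of_mul_dvd_mul_left (by norm_num) ha.1
    refine ⟨r, ?_, rfl⟩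
    rw [hdiv] at h1
    have h3 : r * (2 * N / r) = 2 * N := Nat.mul_div_cancel' h2
    have hr : 0 < r := Nat.pos_of_dvd_of_pos h2 (by lia)
    simp only [coe_filter, Set.mem_ofPred_eq, mem_Ico]
    refine ⟨⟨by lia, ?_⟩, h2⟩
    nlinarith
  · intro r _
    rw [hdiv]

theorem coeff_sum_qPoch_mul_geomSeries_eq_sptRHS {N : ℕ} (hN : N ≠ 0) :
    coeff N (∑ n ∈ range N, qPoch (X : ℤ⟦X⟧) n * (X ^ (n + 1) * geomSeries (n + 1))) =
      sptRHS N := by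
  rw [coeff_sum_qPoch_mul_geomSeries, sum_coeff_lambertSeries,
    sum_coeff_baileyAlpha_mul_lambertSeries hN, sum_divisors_add_sum_signedGap hN]

end LambertSeries

section SptSeries

open PowerSeries
open scoped PowerSeries.WithPiTopology

lemma tsum_C_mul_X_pow (c : ℕ → ℤ) {m : ℕ} (hm : 0 < m) :
    ∑' j, C (c (j + 1)) * (X : ℤ⟦X⟧) ^ (m * (j + 1)) =
      PowerSeries.mk fun k => if m ∣ k ∧ k ≠ 0 then c (k / m) else 0 := by
  ext k
  have hsum := Nat.Partition.summable_genFun_term' (fun _ => c) hm.ne'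
  simp only [smul_eq_C_mul] at hsum
  rw [hsum.map_tsum _ (WithPiTopology.continuous_coeff _ _), coeff_mk]
  simp only [coeff_C_mul, coeff_X_pow, mul_ite, mul_one, mul_zero]
  split_ifs with h
  · obtain ⟨⟨j, rfl⟩, h⟩ := h
    obtain ⟨i, rfl⟩ := Nat.exists_eq_succ_of_ne_zero (right_ne_zero_of_mul h)
    rw [tsum_eq_single i fun i' hi' => if_neg (by simpa [hm.ne'] using hi'.symm),
      if_pos rfl, Nat.mul_div_cancel_left _ hm]
  · refine (tsum_congr fun j => if_neg ?_).trans tsum_zero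
    rintro rfl
    exact h ⟨dvd_mul_right _ _, by positivity⟩

lemma one_add_tsum_X_pow {m : ℕ} (hm : 0 < m) :
    1 + ∑' j, C (1 : ℤ) * (X : ℤ⟦X⟧) ^ (m * (j + 1)) = geomSeries m := by
  rw [tsum_C_mul_X_pow (fun _ => 1) hm]
  ext k
  simp only [geomSeries, map_add, coeff_mk, coeff_one]
  by_cases hk : k = 0 <;> simp [hk]

lemma tsum_natCast_mul_X_pow {m : ℕ} (hm : 0 < m) :
    ∑' j : ℕ, C ((j + 1 : ℕ) : ℤ) * (X : ℤ⟦X⟧) ^ (m * (j + 1)) = lambertSeries m := by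
  rw [tsum_C_mul_X_pow (fun j => (j : ℤ)) hm]
  ext k
  simp only [lambertSeries, coeff_mk]
  by_cases hk : k = 0 <;> simp [hk]

/-- The character of partitions with all parts at least `m`, weighting the multiplicity `c`
of the part `m` by `t c`. -/
def lowestPartChar (m : ℕ) (t : ℕ → ℤ) (i c : ℕ) : ℤ :=
  if i < m then 0 else if i = m then t c else 1

lemma genFun_lowestPartChar_mul_pentagonalSeries (m : ℕ) (t : ℕ → ℤ) :
    Nat.Partition.genFun (lowestPartChar (m + 1) t) * pentagonalSeries ℤ =
      qPoch X m * ((1 + ∑' j, C (t (j + 1)) * (X : ℤ⟦X⟧) ^ ((m + 1) * (j + 1))) *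
        (1 - X ^ (m + 1))) := by
  have h := (Nat.Partition.hasProd_genFun (lowestPartChar (m + 1) t)).mul
    (WithPiTopology.hasProd_one_sub_X_pow ℤ)
  simp only [smul_eq_C_mul] at h
  refine h.unique ?_
  convert hasProd_prod_of_ne_finset_one (L := .unconditional ℕ) (s := range (m + 1)) ?_ using 1
  · rw [prod_range_succ, qPoch]
    congr 1
    · refine prod_congr rfl fun i hi => ?_
      simp [lowestPartChar, mem_range.1 hi]
    · simp [lowestPartChar]
  · intro i hi
    have hi : m < i := by simpa using hi
    have h1 : ¬ i + 1 < m + 1 := by lia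
    have h2 : i + 1 ≠ m + 1 := by lia
    simp only [lowestPartChar, h1, h2, if_false]
    exact one_add_tsum_X_pow (Nat.succ_pos i) ▸ geomSeries_mul_one_sub (Nat.succ_pos i)

lemma prod_lowestPartChar_sub {n : ℕ} (π : n.Partition) (m : ℕ) :
    π.parts.toFinsupp.prod (lowestPartChar m fun c => c) -
      π.parts.toFinsupp.prod (lowestPartChar m fun _ => 0) =
    if ∀ i ∈ π.parts, m ≤ i then (π.parts.count m : ℤ) else 0 := by
  simp only [Finsupp.prod, Multiset.toFinsupp_support, Multiset.toFinsupp_apply]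
  split_ifs with h
  · by_cases hm : m ∈ π.parts
    · rw [prod_eq_single_of_mem m (by simpa using hm), prod_eq_zero (i := m) (by simpa using hm)]
      · simp [lowestPartChar]
      · simp [lowestPartChar]
      · intro i hi him
        simp [lowestPartChar, him, h i (by simpa using hi)]
    · have h1 (t : ℕ → ℤ) : ∏ i ∈ π.parts.toFinset,
          lowestPartChar m t i (π.parts.count i) = 1 := prod_eq_one fun i hi => by
        have hi : i ∈ π.parts := by simpa using hi
        have him : i ≠ m := fun h => hm (h ▸ hi)
        simp [lowestPartChar, him, h i hi]
      rw [h1, h1, Multiset.count_eq_zero_of_notMem hm]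
      simp
  · push Not at h
    obtain ⟨i, hi, him⟩ := h
    have h1 (t : ℕ → ℤ) : ∏ i ∈ π.parts.toFinset,
        lowestPartChar m t i (π.parts.count i) = 0 :=
      prod_eq_zero (i := i) (by simpa using hi) (by simp [lowestPartChar, him])
    rw [h1, h1, sub_zero]

lemma Nat.Partition.smallestPart_mem {n : ℕ} {π : n.Partition} (h : π.parts ≠ 0) :
    π.smallestPart ∈ π.parts :=
  Nat.sInf_mem (s := {a | a ∈ π.parts}) (Multiset.exists_mem_of_ne_zero h)

lemma Nat.Partition.smallestPart_le {n : ℕ} {π : n.Partition} {i : ℕ} (h : i ∈ π.parts) :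
    π.smallestPart ≤ i :=
  Nat.sInf_le h

lemma spt_eq_sum {n N : ℕ} (h : n ≤ N) :
    (spt n : ℤ) = ∑ m ∈ range N, ∑ π : n.Partition,
      if ∀ i ∈ π.parts, m + 1 ≤ i then (π.parts.count (m + 1) : ℤ) else 0 := by
  rw [sum_comm, spt, Nat.cast_sum]
  refine sum_congr rfl fun π _ => ?_
  by_cases h0 : π.parts = 0
  · simp [h0]
  have hs := Nat.Partition.smallestPart_mem h0
  have hpos := π.parts_pos hs
  have hle : π.smallestPart ≤ n := by
    conv_rhs => rw [← π.parts_sum]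
    exact Multiset.le_sum_of_mem hs
  rw [sum_eq_single (π.smallestPart - 1)]
  · rw [Nat.sub_add_cancel hpos, if_pos fun i hi => Nat.Partition.smallestPart_le hi]
  · intro m _ hm
    rw [ite_eq_right_iff]
    intro hall
    rw [Nat.cast_eq_zero, Multiset.count_eq_zero]
    intro hmem
    have h1 := hall _ hs
    have h2 := Nat.Partition.smallestPart_le hmem
    lia
  · intro hm
    exact absurd (mem_range.2 (by lia)) hm

theorem coeff_sptSeries_mul_pentagonalSeries (N : ℕ) :
    coeff N (PowerSeries.mk (fun n => (spt n : ℤ)) * pentagonalSeries ℤ) =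
      coeff N (∑ n ∈ range N, qPoch (X : ℤ⟦X⟧) n * (X ^ (n + 1) * geomSeries (n + 1))) := by
  have h (m : ℕ) : qPoch (X : ℤ⟦X⟧) m * (X ^ (m + 1) * geomSeries (m + 1)) =
      (Nat.Partition.genFun (lowestPartChar (m + 1) fun c => c) -
        Nat.Partition.genFun (lowestPartChar (m + 1) fun _ => 0)) * pentagonalSeries ℤ := by
    rw [sub_mul, genFun_lowestPartChar_mul_pentagonalSeries,
      genFun_lowestPartChar_mul_pentagonalSeries, tsum_natCast_mul_X_pow (Nat.succ_pos m),
      ← lambertSeries_mul_one_sub (Nat.succ_pos m)]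
    simp only [map_zero, zero_mul, tsum_zero, Nat.succ_eq_add_one]
    ring
  simp only [h]
  rw [← sum_mul, coeff_mul, coeff_mul]
  refine sum_congr rfl fun x hx => ?_
  have hx : x.1 ≤ N := by have := mem_antidiagonal.1 hx; lia
  rw [coeff_mk, spt_eq_sum hx, map_sum]
  congr 1
  refine sum_congr rfl fun m _ => ?_
  rw [map_sub, Nat.Partition.coeff_genFun, Nat.Partition.coeff_genFun, ← sum_sub_distrib]
  exact sum_congr rfl fun π _ => (prod_lowestPartChar_sub π (m + 1)).symm

theorem finsum_negOnePow_mul_sptZ (N : ℕ) :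
    ∑ᶠ k : ℤ, (k.negOnePow : ℤ) * sptZ ((N : ℤ) - k * (3 * k + 1) / 2) =
      coeff N (PowerSeries.mk (fun n => (spt n : ℤ)) * pentagonalSeries ℤ) := by
  have hpent (k : ℤ) : k * (3 * k + 1) / 2 = (pentagonal (-k) : ℕ) := by
    have := two_mul_natCast_pentagonal_neg k
    lia
  have hinj : Function.Injective fun k : ℤ => pentagonal (-k) :=
    pentagonal_injective.comp neg_injective
  have hzero {k : ℤ} (h : N < pentagonal (-k)) : sptZ ((N : ℤ) - pentagonal (-k)) = 0 :=
    if_neg (by lia)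
  have hval {k : ℤ} (h : pentagonal (-k) ≤ N) :
      sptZ ((N : ℤ) - pentagonal (-k)) = spt (N - pentagonal (-k)) := by
    rw [← Nat.cast_sub h]
    simp [sptZ]
  simp only [hpent]
  rw [finsum_eq_sum_of_support_subset (s := (range (N + 1)).preimage _ hinj.injOn), mul_comm,
    coeff_mul, Nat.sum_antidiagonal_eq_sum_range_succ
      (fun i j => coeff i (pentagonalSeries ℤ) * coeff j (PowerSeries.mk fun n => (spt n : ℤ)))]
  · rw [← sum_preimage (fun k : ℤ => pentagonal (-k)) (range (N + 1)) hinj.injOn]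
    · refine sum_congr rfl fun k hk => ?_
      have hk : pentagonal (-k) ≤ N := by simpa [Nat.lt_succ_iff] using hk
      rw [coeff_pentagonalSeries_pentagonal, coeff_mk, hval hk, Int.negOnePow_neg, Int.cast_id]
    · intro j _ hj
      rw [coeff_pentagonalSeries_eq_zero, zero_mul]
      rintro ⟨k, rfl⟩
      exact hj ⟨-k, by simp⟩
  · intro k hk
    simp only [coe_preimage, Set.mem_preimage, mem_coe, mem_range, Nat.lt_succ_iff]
    by_contra! h
    exact hk (by simp [hzero h])

end SptSeries

/-- Euler-like recurrence for `spt` (Theorem 1). -/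
theorem spt_recurrence (n : ℕ) (hn : 0 < n) :
    ∑ᶠ k : ℤ, (k.negOnePow : ℤ) * sptZ ((n : ℤ) - k * (3 * k + 1) / 2) = sptRHS n := by
  rw [finsum_negOnePow_mul_sptZ, coeff_sptSeries_mul_pentagonalSeries,
    coeff_sum_qPoch_mul_geomSeries_eq_sptRHS hn.ne']
end

section
/- For every positive integer n, Σ_{k≥0} (−1)^{k(k+1)/2} · M2spt(n − k(k+1)/2) = (−1)^n · c(n), where M2spt(m) counts smallest parts in partitions of m without repeated odd parts whose smallest part is even (M2spt(m)=0 for m≤0), and c(n) = σ(n) − σ(n/2) − (1/2)s(2n) + s(n/2), with σ(x)=0 and s(x)=0 when x is not a positive integer. -/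
namespace M2SptRecurrence

open Finset PowerSeries

/-- The generalized triangular number `x(x+1)/2` of an integer. -/
def tri (x : ℤ) : ℕ := (x * (x + 1) / 2).toNat

lemma two_mul_tri (x : ℤ) : 2 * (tri x : ℤ) = x * (x + 1) := by
  have hpos : 0 ≤ x * (x + 1) := by
    rcases le_or_gt 0 x with h | h
    · positivity
    · nlinarith
  have heven : 2 ∣ x * (x + 1) := (Int.even_mul_succ_self x).two_dvd
  rw [tri, Int.toNat_of_nonneg (by omega)]
  omega

lemma tri_neg_succ (x : ℤ) : tri (-x - 1) = tri x := by
  have h1 := two_mul_tri x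
  have h2 := two_mul_tri (-x - 1)
  have : (-x - 1) * (-x - 1 + 1) = x * (x + 1) := by ring
  omega

lemma tri_succ_sub_add (i j : ℕ) :
    tri ((i + 1 : ℕ) - j) + 2 * j = tri (i - j) + (i + j + 1) := by
  have h1 := two_mul_tri ((i + 1 : ℕ) - j)
  have h2 := two_mul_tri ((i : ℤ) - j)
  have : (((i + 1 : ℕ) : ℤ) - j) * ((i + 1 : ℕ) - j + 1) =
    ((i : ℤ) - j) * (i - j + 1) + 2 * (i + 1 - j) := by push_cast; ring
  omega

lemma one_sub_X_pow_mul_inv {k : ℕ} (hk : k ≠ 0) :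
    (1 - X ^ k : ℚ⟦X⟧) * (1 - X ^ k)⁻¹ = 1 :=
  PowerSeries.mul_inv_cancel _ (by simp [hk])

/-- The `X²`-Pochhammer symbol `(X²; X²)ₙ`. -/
noncomputable def poch (n : ℕ) : ℚ⟦X⟧ := ∏ i ∈ range n, (1 - X ^ (2 * (i + 1)))

lemma poch_zero : poch 0 = 1 := by simp [poch]

lemma poch_succ (n : ℕ) : poch (n + 1) = poch n * (1 - X ^ (2 * (n + 1))) := by
  simp [poch, prod_range_succ]

lemma poch_mul_inv (n : ℕ) : poch n * (poch n)⁻¹ = 1 := by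
  refine PowerSeries.mul_inv_cancel _ ?_
  simp [poch, map_prod, prod_eq_one]

lemma inv_poch_eq (n : ℕ) : (poch n)⁻¹ = (1 - X ^ (2 * (n + 1))) * (poch (n + 1))⁻¹ := by
  have h1 := poch_mul_inv n
  have h2 := poch_mul_inv (n + 1)
  rw [poch_succ n] at h2
  rw [poch_succ n]
  linear_combination (1 - X ^ (2 * (n + 1))) * (poch n * (1 - X ^ (2 * (n + 1))))⁻¹ * h1
    - (poch n)⁻¹ * h2

/-- The sum `∑ X^{T(i-j)} / ((X²;X²)ᵢ (X²;X²)ⱼ)` over `i + j = m`. -/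
noncomputable def bailey (m : ℕ) : ℚ⟦X⟧ :=
  ∑ p ∈ antidiagonal m, X ^ tri (p.1 - p.2) * ((poch p.1)⁻¹ * (poch p.2)⁻¹)

lemma one_sub_mul_bailey_succ (m : ℕ) :
    (1 - X ^ (2 * (m + 1))) * bailey (m + 1) = (1 + X ^ (m + 1)) * bailey m := by
  have hsplit : (1 - X ^ (2 * (m + 1))) * bailey (m + 1) =
      ∑ p ∈ antidiagonal (m + 1), X ^ tri (p.1 - p.2) *
        ((poch p.1)⁻¹ * ((1 - X ^ (2 * p.2)) * (poch p.2)⁻¹)) +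
      ∑ p ∈ antidiagonal (m + 1), X ^ (tri (p.1 - p.2) + 2 * p.2) *
        (((1 - X ^ (2 * p.1)) * (poch p.1)⁻¹) * (poch p.2)⁻¹) := by
    rw [bailey, mul_sum, ← sum_add_distrib]
    refine sum_congr rfl fun p hp => ?_
    rw [← mem_antidiagonal.mp hp]
    ring
  rw [hsplit, Nat.sum_antidiagonal_succ', Nat.sum_antidiagonal_succ]
  simp only [mul_zero, pow_zero, sub_self, zero_mul, zero_add, ← inv_poch_eq]
  rw [add_mul, one_mul]
  congr 1
  · rw [bailey, ← Nat.sum_antidiagonal_swap]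
    refine sum_congr rfl fun p _ => ?_
    rw [← tri_neg_succ ((p.1 : ℤ) - p.2)]
    simp only [Prod.fst_swap, Prod.snd_swap]
    rw [show (p.2 : ℤ) - (p.1 + 1 : ℕ) = -((p.1 : ℤ) - p.2) - 1 by push_cast; ring]
    ring
  · rw [bailey, mul_sum]
    refine sum_congr rfl fun p hp => ?_
    rw [tri_succ_sub_add, mem_antidiagonal.mp hp, pow_add]
    ring

lemma bailey_zero : bailey 0 = 1 := by
  simp [bailey, poch_zero, tri]

/-- The Bailey pair `(X;X)ₘ · bailey m = 1`. -/
lemma prod_mul_bailey (m : ℕ) : (∏ i ∈ range m, (1 - X ^ (i + 1) : ℚ⟦X⟧)) * bailey m = 1 := by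
  induction m with
  | zero => simp [bailey_zero]
  | succ m ih =>
    have h := one_sub_mul_bailey_succ m
    have h1 : (1 + X ^ (m + 1) : ℚ⟦X⟧) ≠ 0 := fun h0 => by
      have := congrArg constantCoeff h0
      simp at this
    have h2 : (1 - X ^ (m + 1)) * bailey (m + 1) = bailey m := by
      refine mul_left_cancel₀ h1 ?_
      linear_combination h
    rw [prod_range_succ, mul_assoc, h2, ih]

/-- The weight `X^{T(2r)} + X^{T(-2r)}` of the Bailey pair. -/
noncomputable def alpha (r : ℕ) : ℚ⟦X⟧ := X ^ (r * (2 * r + 1)) + X ^ (r * (2 * r - 1))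

lemma bailey_two_mul (n : ℕ) :
    bailey (2 * n) = (poch n)⁻¹ ^ 2 +
      ∑ r ∈ Icc 1 n, alpha r * ((poch (n - r))⁻¹ * (poch (n + r))⁻¹) := by
  have hpos (r : ℕ) : tri (2 * r) = r * (2 * r + 1) := by
    have h := two_mul_tri (2 * r)
    have : ((2 * tri (2 * r) : ℕ) : ℤ) = ((2 * (r * (2 * r + 1)) : ℕ) : ℤ) := by
      push_cast; rw [h]; ring
    have := Int.ofNat_inj.mp this
    omega
  have hneg (r : ℕ) : tri (-(2 * r)) = r * (2 * r - 1) := by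
    have h := two_mul_tri (-(2 * r))
    rcases r with _ | r
    · simp [tri]
    have : ((2 * tri (-(2 * (r + 1 : ℕ))) : ℕ) : ℤ) = ((2 * ((r + 1) * (2 * r + 1)) : ℕ) : ℤ) := by
      push_cast at h ⊢; rw [h]; ring
    have := Int.ofNat_inj.mp this
    rw [show 2 * (r + 1) - 1 = 2 * r + 1 by omega]
    omega
  rw [bailey, Nat.sum_antidiagonal_eq_sum_range_succ_mk, show (2 * n).succ = n + (n + 1) by omega,
    sum_range_add, sum_range_succ', ← sum_range_reflect, ← add_assoc, ← sum_add_distrib, add_comm]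
  have hIcc : Icc 1 n = (range n).image (· + 1) := by
    ext x; simp only [mem_Icc, mem_image, mem_range]
    exact ⟨fun h => ⟨x - 1, by omega, by omega⟩, by rintro ⟨y, hy, rfl⟩; omega⟩
  rw [hIcc, sum_image (by intro a _ b _ h; simpa using h)]
  congr 1
  · simp only [add_zero]
    rw [show 2 * n - n = n by omega]
    simp [tri, sq]
  · refine sum_congr rfl fun x hx => ?_
    have hx := mem_range.mp hx
    simp only
    rw [show 2 * n - (n - 1 - x) = n + (x + 1) by omega,
      show 2 * n - (n + (x + 1)) = n - (x + 1) by omega, show n - 1 - x = n - (x + 1) by omega,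
      show (((n - (x + 1) : ℕ) : ℤ) - (n + (x + 1) : ℕ)) = -(2 * (x + 1 : ℕ)) by
        push_cast [Nat.cast_sub (show x + 1 ≤ n by omega)]; ring,
      show ((n + (x + 1) : ℕ) : ℤ) - ((n - (x + 1) : ℕ) : ℤ) = (2 * (x + 1 : ℕ)) by
        push_cast [Nat.cast_sub (show x + 1 ≤ n by omega)]; ring, hpos, hneg, alpha]
    ring

/-- The Lambert series `∑ j X^{kj} = X^k / (1 - X^k)²`. -/
noncomputable def lambert (k : ℕ) : ℚ⟦X⟧ := X ^ k * (1 - X ^ k)⁻¹ ^ 2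

lemma lambert_mul {k : ℕ} (hk : k ≠ 0) : lambert k * (1 - X ^ k) ^ 2 = X ^ k := by
  have h := one_sub_X_pow_mul_inv hk
  rw [lambert, mul_assoc, ← mul_pow, mul_comm _ (1 - X ^ k), h]
  simp

/-- Finite form of the limiting Bailey lemma. -/
lemma sum_lambert_mul_bailey (N : ℕ) :
    ∑ m ∈ Icc 1 N, lambert (2 * m) * (poch m ^ 2 * bailey (2 * m)) =
      ∑ m ∈ Icc 1 N, lambert (2 * m) +
      ∑ r ∈ Icc 1 N, alpha r * lambert (2 * r) *
        (poch N ^ 2 * ((poch (N - r))⁻¹ * (poch (N + r))⁻¹)) := by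
  induction N with
  | zero => simp
  | succ N ih =>
    have hN := poch_mul_inv (N + 1)
    have hlam := lambert_mul (k := 2 * (N + 1)) (by omega)
    have hstep : ∀ r ∈ Icc 1 N,
        alpha r * lambert (2 * r) *
          (poch (N + 1) ^ 2 * ((poch (N + 1 - r))⁻¹ * (poch (N + 1 + r))⁻¹)) =
        alpha r * lambert (2 * r) * (poch N ^ 2 * ((poch (N - r))⁻¹ * (poch (N + r))⁻¹)) +
        X ^ (2 * (N + 1)) * poch N ^ 2 *
          (alpha r * ((poch (N + 1 - r))⁻¹ * (poch (N + 1 + r))⁻¹)) := by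
      intro r hr
      obtain ⟨hr1, hrN⟩ := mem_Icc.mp hr
      obtain ⟨d, rfl⟩ := Nat.exists_eq_add_of_le hrN
      have hr := lambert_mul (k := 2 * r) (by omega)
      rw [show r + d + 1 - r = d + 1 by omega, show r + d - r = d by omega, poch_succ (r + d),
        inv_poch_eq d, inv_poch_eq (r + d + r), show r + d + 1 + r = r + d + r + 1 by omega]
      linear_combination (alpha r * poch (r + d) ^ 2 * (poch (d + 1))⁻¹ *
        (poch (r + d + r + 1))⁻¹ * X ^ (2 * (d + 1))) * hr
    rw [sum_Icc_succ_top (by omega), sum_Icc_succ_top (by omega), sum_Icc_succ_top (by omega), ih,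
      sum_congr rfl hstep, sum_add_distrib, ← mul_sum, bailey_two_mul,
      sum_Icc_succ_top (by omega), poch_succ N]
    rw [poch_succ N] at hN
    linear_combination (poch N ^ 2 * ∑ r ∈ Icc 1 N,
      alpha r * ((poch (N + 1 - r))⁻¹ * (poch (N + 1 + r))⁻¹)) * hlam
      + lambert (2 * (N + 1)) * (1 + poch N * (1 - X ^ (2 * (N + 1))) * (poch N * (1 - X ^ (2 * (N + 1))))⁻¹) * hN

lemma X_pow_dvd_poch_mul_inv_sub_one (k d : ℕ) :
    X ^ (2 * (k + 1)) ∣ poch (k + d) * (poch k)⁻¹ - 1 := by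
  induction d with
  | zero => simp [poch_mul_inv]
  | succ d ih =>
    have h : poch (k + (d + 1)) * (poch k)⁻¹ - 1 = (poch (k + d) * (poch k)⁻¹ - 1) -
        X ^ (2 * (k + 1)) * (X ^ (2 * d) * poch (k + d) * (poch k)⁻¹) := by
      rw [← add_assoc, poch_succ]
      ring
    rw [h]
    exact dvd_sub ih (Dvd.intro _ rfl)

lemma X_pow_dvd_poch_sq_mul_sub_one {r N : ℕ} (h : r ≤ N) :
    X ^ (2 * (N - r + 1)) ∣ poch N ^ 2 * ((poch (N - r))⁻¹ * (poch (N + r))⁻¹) - 1 := by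
  have h1 : X ^ (2 * (N - r + 1)) ∣ poch N * (poch (N - r))⁻¹ - 1 := by
    simpa [Nat.sub_add_cancel h] using X_pow_dvd_poch_mul_inv_sub_one (N - r) r
  have h2 : X ^ (2 * (N - r + 1)) ∣ poch (N + r) * (poch N)⁻¹ - 1 :=
    (pow_dvd_pow _ (by omega)).trans (X_pow_dvd_poch_mul_inv_sub_one N r)
  have hN := poch_mul_inv N
  have hr := poch_mul_inv (N + r)
  have : poch N ^ 2 * ((poch (N - r))⁻¹ * (poch (N + r))⁻¹) - 1 =
      (poch N * (poch (N - r))⁻¹ - 1) * (poch N * (poch (N + r))⁻¹) -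
      (poch (N + r) * (poch N)⁻¹ - 1) * (poch N * (poch (N + r))⁻¹) := by
    linear_combination (poch (N + r) * (poch (N + r))⁻¹) * hN + hr
  rw [this]
  exact dvd_sub (h1.mul_right _) (h2.mul_right _)

lemma X_pow_dvd_alpha_mul {r N : ℕ} (hr : r ∈ Icc 1 N) :
    X ^ (N + 1) ∣
      alpha r * (poch N ^ 2 * ((poch (N - r))⁻¹ * (poch (N + r))⁻¹) - 1) := by
  obtain ⟨h1, hN⟩ := mem_Icc.mp hr
  have halpha : X ^ (r * (2 * r - 1)) ∣ alpha r :=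
    dvd_add (pow_dvd_pow _ (Nat.mul_le_mul_left _ (by omega))) dvd_rfl
  have h := mul_dvd_mul halpha (X_pow_dvd_poch_sq_mul_sub_one hN)
  rw [← pow_add] at h
  refine (pow_dvd_pow _ ?_).trans h
  obtain ⟨s, rfl⟩ := Nat.exists_eq_add_of_le' h1
  obtain ⟨d, rfl⟩ := Nat.exists_eq_add_of_le hN
  rw [show 2 * (s + 1) - 1 = 2 * s + 1 by omega, show s + 1 + d - (s + 1) = d by omega]
  nlinarith

lemma X_pow_dvd_sum_lambert_mul_bailey_sub (N : ℕ) :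
    X ^ (N + 1) ∣ ∑ m ∈ Icc 1 N, lambert (2 * m) * (poch m ^ 2 * bailey (2 * m)) -
      (∑ m ∈ Icc 1 N, lambert (2 * m) + ∑ r ∈ Icc 1 N, alpha r * lambert (2 * r)) := by
  rw [sum_lambert_mul_bailey, add_sub_add_left_eq_sub, ← sum_sub_distrib]
  refine dvd_sum fun r hr => ?_
  convert (X_pow_dvd_alpha_mul hr).mul_right (lambert (2 * r)) using 1
  ring

/-- A partial sum of Ramanujan's theta function `ψ`. -/
noncomputable def psi (N : ℕ) : ℚ⟦X⟧ := ∑ k ∈ range (2 * N + 1), X ^ (k * (k + 1) / 2)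

lemma psi_eq (N : ℕ) : psi N = 1 + ∑ r ∈ Icc 1 N, alpha r := by
  induction N with
  | zero => simp [psi]
  | succ N ih =>
    rw [sum_Icc_succ_top (by omega), ← add_assoc, ← ih, psi, psi,
      show 2 * (N + 1) + 1 = 2 * N + 1 + 1 + 1 by ring, sum_range_succ, sum_range_succ, alpha,
      show (2 * N + 1) * (2 * N + 1 + 1) = (N + 1) * (2 * N + 1) * 2 by ring,
      show (2 * N + 1 + 1) * (2 * N + 1 + 1 + 1) = (N + 1) * (2 * (N + 1) + 1) * 2 by ring,
      Nat.mul_div_cancel _ two_pos, Nat.mul_div_cancel _ two_pos,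
      show 2 * (N + 1) - 1 = 2 * N + 1 by omega]
    ring

/-- Gauss's product formula for `ψ`, modulo a power of `X`. -/
lemma X_pow_dvd_poch_sq_mul_bailey_sub_psi (N : ℕ) :
    X ^ (N + 1) ∣ poch N ^ 2 * bailey (2 * N) - psi N := by
  have h : poch N ^ 2 * bailey (2 * N) - psi N = ∑ r ∈ Icc 1 N,
      alpha r * (poch N ^ 2 * ((poch (N - r))⁻¹ * (poch (N + r))⁻¹) - 1) := by
    simp only [mul_sub, mul_one, sum_sub_distrib]
    rw [psi_eq, bailey_two_mul, mul_add, mul_sum, ← mul_pow, poch_mul_inv]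
    simp only [one_pow, mul_left_comm (poch N ^ 2) (alpha _)]
    ring
  rw [h]
  exact dvd_sum fun r hr => X_pow_dvd_alpha_mul hr

/-- The factor contributed by the part `i` to the signed generating function of partitions without
repeated odd parts. -/
noncomputable def factor (i : ℕ) : ℚ⟦X⟧ := if Even i then (1 - X ^ i)⁻¹ else 1 - X ^ i

lemma prod_factor_mul_bailey (m : ℕ) :
    (∏ i ∈ Ioc 0 (2 * m), factor i) * (poch m ^ 2 * bailey (2 * m)) = 1 := by
  have h : (∏ i ∈ Ioc 0 (2 * m), factor i) * poch m ^ 2 =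
      ∏ i ∈ range (2 * m), (1 - X ^ (i + 1) : ℚ⟦X⟧) := by
    induction m with
    | zero => simp [poch_zero]
    | succ m ih =>
      have hinv := one_sub_X_pow_mul_inv (k := 2 * (m + 1)) (by omega)
      rw [show 2 * (m + 1) = 2 * m + 1 + 1 by ring] at hinv ⊢
      rw [prod_Ioc_succ_top (by omega), prod_Ioc_succ_top (by omega), prod_range_succ,
        prod_range_succ, ← ih, factor, factor, if_neg (by simp), if_pos (by simp [parity_simps]),
        poch_succ, show 2 * (m + 1) = 2 * m + 1 + 1 by ring]
      linear_combination ((∏ i ∈ Ioc 0 (2 * m), factor i) * (1 - X ^ (2 * m + 1)) * poch m ^ 2 *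
        (1 - X ^ (2 * m + 1 + 1))) * hinv
  rw [← mul_assoc, h, prod_mul_bailey]

/-- The signed generating function, over partitions with all parts at most `2N`, of the number of
smallest parts. -/
noncomputable def sptSeries (N : ℕ) : ℚ⟦X⟧ :=
  ∑ m ∈ Icc 1 N, lambert (2 * m) * ∏ i ∈ Ioc (2 * m) (2 * N), factor i

lemma X_pow_dvd_psi_mul_sptSeries_sub (N : ℕ) :
    X ^ (N + 1) ∣ psi N * sptSeries N -
      (∑ m ∈ Icc 1 N, lambert (2 * m) + ∑ r ∈ Icc 1 N, alpha r * lambert (2 * r)) := by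
  have hS : sptSeries N = (∏ i ∈ Ioc 0 (2 * N), factor i) *
      ∑ m ∈ Icc 1 N, lambert (2 * m) * (poch m ^ 2 * bailey (2 * m)) := by
    rw [sptSeries, mul_sum]
    refine sum_congr rfl fun m hm => ?_
    have hm := (mem_Icc.mp hm).2
    rw [← prod_Ioc_consecutive factor (Nat.zero_le (2 * m)) (by omega)]
    linear_combination (-lambert (2 * m) * ∏ i ∈ Ioc (2 * m) (2 * N), factor i) *
      prod_factor_mul_bailey m
  have h := dvd_sub (X_pow_dvd_sum_lambert_mul_bailey_sub N)
    ((X_pow_dvd_poch_sq_mul_bailey_sub_psi N).mul_right (sptSeries N))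
  convert h using 1
  rw [hS]
  linear_combination (∑ m ∈ Icc 1 N, lambert (2 * m) * (poch m ^ 2 * bailey (2 * m))) *
    prod_factor_mul_bailey N

lemma one_sub_X_pow_mul_mk_dvd {k : ℕ} (hk : k ≠ 0) :
    (1 - X ^ k) * (PowerSeries.mk fun n => if k ∣ n then 1 else 0 : ℚ⟦X⟧) = 1 := by
  ext n
  rw [sub_mul, one_mul, map_sub, coeff_X_pow_mul', coeff_one]
  simp only [coeff_mk]
  by_cases hkn : k ≤ n
  · obtain ⟨d, rfl⟩ := Nat.exists_eq_add_of_le hkn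
    simp [hk]
  · by_cases hn : n = 0
    · simp [hn, hk]
    · simp [hkn, hn, Nat.not_dvd_of_pos_of_lt (Nat.pos_of_ne_zero hn) (not_le.mp hkn)]

lemma coeff_lambert {k : ℕ} (hk : k ≠ 0) (n : ℕ) :
    coeff n (lambert k) = if k ∣ n then ((n / k : ℕ) : ℚ) else 0 := by
  have h1 := one_sub_X_pow_mul_mk_dvd hk
  have h2 : (1 - X ^ k) * (PowerSeries.mk fun n => if k ∣ n then ((n / k : ℕ) : ℚ) else 0 : ℚ⟦X⟧) =
      X ^ k * (PowerSeries.mk fun n => if k ∣ n then 1 else 0 : ℚ⟦X⟧) := by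
    ext n
    rw [sub_mul, one_mul, map_sub, coeff_X_pow_mul', coeff_X_pow_mul']
    simp only [coeff_mk]
    by_cases hkn : k ≤ n
    · obtain ⟨d, rfl⟩ := Nat.exists_eq_add_of_le hkn
      by_cases hd : k ∣ d
      · obtain ⟨e, rfl⟩ := hd
        simp only [Nat.add_sub_cancel_left]
        simp [show k + k * e = k * (e + 1) by ring, Nat.pos_of_ne_zero hk]
      · simp [hd]
    · by_cases hn : n = 0
      · simp [hn, hk]
      · simp [hkn, Nat.not_dvd_of_pos_of_lt (Nat.pos_of_ne_zero hn) (not_le.mp hkn)]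
  have hinv := one_sub_X_pow_mul_inv hk
  have : lambert k = PowerSeries.mk fun n => if k ∣ n then ((n / k : ℕ) : ℚ) else 0 := by
    rw [lambert]
    set A : ℚ⟦X⟧ := PowerSeries.mk fun n => if k ∣ n then 1 else 0
    set B : ℚ⟦X⟧ := PowerSeries.mk fun n => if k ∣ n then ((n / k : ℕ) : ℚ) else 0
    have hA : (1 - X ^ k : ℚ⟦X⟧)⁻¹ = A := by
      linear_combination A * hinv - (1 - X ^ k : ℚ⟦X⟧)⁻¹ * h1
    rw [hA]
    linear_combination (-A) * h2 + B * h1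
  rw [this, coeff_mk]

lemma coeff_alpha_mul_lambert {r : ℕ} (hr : r ≠ 0) (n : ℕ) :
    coeff n (alpha r * lambert (2 * r)) =
      if r ∣ n ∧ Odd (n / r) then ((n / r - 2 * r : ℕ) : ℚ) else 0 := by
  have hr0 := Nat.pos_of_ne_zero hr
  rw [alpha, add_mul, map_add, coeff_X_pow_mul', coeff_X_pow_mul', coeff_lambert (by omega),
    coeff_lambert (by omega)]
  by_cases hd : r ∣ n
  · obtain ⟨d, rfl⟩ := hd
    rw [mul_comm 2 r, ← Nat.mul_sub, ← Nat.mul_sub]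
    simp only [Nat.mul_dvd_mul_iff_left hr0, Nat.mul_le_mul_left_iff hr0,
      Nat.mul_div_mul_left _ _ hr0, Nat.mul_div_cancel_left _ hr0, dvd_mul_right, true_and,
      Nat.odd_iff]
    split_ifs <;> try omega
    all_goals norm_cast <;> omega
  · have aux (e : ℕ) (he : r * e ≤ n) : ¬ 2 * r ∣ n - r * e := fun h =>
      hd ((Nat.dvd_sub_iff_left he (dvd_mul_right r e)).mp ((dvd_mul_left r 2).trans h))
    simp only [hd, false_and, if_false]
    split_ifs with h1 h2 h3 h4 h5 h6 <;> simp_all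

lemma sigma1_eq {n : ℕ} (hn : n ≠ 0) :
    sigma1 n = ∑ d ∈ n.divisors with Odd d, d + if 2 ∣ n then 2 * sigma1 (n / 2) else 0 := by
  rw [sigma1, ← sum_filter_add_sum_filter_not _ (fun d => Odd d), Nat.add_left_cancel_iff]
  split_ifs with h
  · obtain ⟨m, rfl⟩ := h
    rw [Nat.mul_div_cancel_left _ two_pos, sigma1, mul_sum,
      ← sum_image (f := fun d => d) (g := fun d => 2 * d) (by intro a _ b _ h; simpa using h)]
    refine sum_congr ?_ fun _ _ => rfl
    ext d
    simp only [mem_filter, Nat.mem_divisors, Nat.not_odd_iff_even, even_iff_two_dvd, mem_image]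
    constructor
    · rintro ⟨⟨h1, _⟩, e, rfl⟩
      exact ⟨e, ⟨Nat.dvd_of_mul_dvd_mul_left two_pos h1, by omega⟩, rfl⟩
    · rintro ⟨e, ⟨h1, h2⟩, rfl⟩
      exact ⟨⟨Nat.mul_dvd_mul_left 2 h1, by omega⟩, dvd_mul_right 2 e⟩
  · refine sum_eq_zero fun d hd => ?_
    simp only [mem_filter, Nat.mem_divisors, Nat.not_odd_iff_even, even_iff_two_dvd] at hd
    exact absurd (hd.2.trans hd.1.1) h

lemma sum_odd_divisors_two_mul (n : ℕ) :
    ∑ d ∈ (2 * n).divisors with Odd d, min d (2 * n / d) =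
      ∑ d ∈ n.divisors with Odd d, min d (2 * (n / d)) := by
  refine sum_congr ?_ fun d hd => ?_
  · ext d
    simp only [mem_filter, Nat.mem_divisors]
    constructor
    · rintro ⟨⟨h1, h2⟩, h3⟩
      exact ⟨⟨(Nat.coprime_two_right.mpr h3).dvd_of_dvd_mul_left h1, by omega⟩, h3⟩
    · rintro ⟨⟨h1, h2⟩, h3⟩
      exact ⟨⟨h1.mul_left 2, by omega⟩, h3⟩
  · rw [Nat.mul_div_assoc _ (Nat.dvd_of_mem_divisors (mem_filter.mp hd).1)]

lemma sum_even_divisors_two_mul {n : ℕ} (hn : n ≠ 0) :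
    ∑ d ∈ (2 * n).divisors with ¬ Odd d ∧ ¬ Odd (2 * n / d), min d (2 * n / d) =
      if 2 ∣ n then 2 * sdiv (n / 2) else 0 := by
  split_ifs with h
  · obtain ⟨m, rfl⟩ := h
    rw [Nat.mul_div_cancel_left _ two_pos, sdiv, mul_sum]
    symm
    refine sum_nbij (fun d => 2 * d) ?_ (by intro a _ b _ h; simpa using h) ?_ ?_
    · intro d hd
      obtain ⟨⟨e, rfl⟩, hm⟩ := Nat.mem_divisors.mp hd
      have hd0 : 0 < d := Nat.pos_of_ne_zero (by rintro rfl; simp at hm)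
      rw [mem_filter, Nat.mem_divisors, show 2 * (2 * (d * e)) = 2 * d * (2 * e) by ring,
        Nat.mul_div_cancel_left _ (by omega)]
      refine ⟨⟨dvd_mul_right _ _, by simp_all⟩, ?_⟩
      simp
    · intro d hd
      simp only [coe_filter, Set.mem_ofPred_eq, Nat.mem_divisors, Nat.not_odd_iff_even,
        even_iff_two_dvd] at hd
      obtain ⟨⟨⟨e, he⟩, h0⟩, ⟨a, rfl⟩, h2⟩ := hd
      have ha : 0 < 2 * a := Nat.pos_of_ne_zero (by intro h; simp [h] at he; omega)
      rw [he, Nat.mul_div_cancel_left _ ha] at h2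
      obtain ⟨b, rfl⟩ := h2
      have hm : m = a * b := by nlinarith
      exact ⟨a, by simp only [SetLike.mem_coe, Nat.mem_divisors]; exact ⟨⟨b, hm⟩, by omega⟩, rfl⟩
    · intro d hd
      obtain ⟨⟨e, rfl⟩, hm⟩ := Nat.mem_divisors.mp hd
      have hd0 : 0 < d := Nat.pos_of_ne_zero (by rintro rfl; simp at hm)
      rw [show 2 * (2 * (d * e)) = 2 * d * (2 * e) by ring,
        Nat.mul_div_cancel_left _ hd0, Nat.mul_div_cancel_left _ (by omega)]
      omega
  · rw [sum_eq_zero]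
    intro d hd
    simp only [mem_filter, Nat.mem_divisors, Nat.not_odd_iff_even, even_iff_two_dvd] at hd
    obtain ⟨⟨⟨e, he⟩, h0⟩, ⟨a, rfl⟩, h2⟩ := hd
    have ha : 0 < 2 * a := Nat.pos_of_ne_zero (by intro h; simp [h] at he; omega)
    rw [he, Nat.mul_div_cancel_left _ ha] at h2
    obtain ⟨b, rfl⟩ := h2
    exact absurd ⟨a * b, by nlinarith⟩ h

lemma sdiv_two_mul {n : ℕ} (hn : n ≠ 0) :
    sdiv (2 * n) = 2 * ∑ d ∈ n.divisors with Odd d, min d (2 * (n / d)) +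
      if 2 ∣ n then 2 * sdiv (n / 2) else 0 := by
  have hswap : ∑ d ∈ (2 * n).divisors with Odd d, min d (2 * n / d) =
      ∑ d ∈ (2 * n).divisors with ¬ Odd d ∧ Odd (2 * n / d), min d (2 * n / d) := by
    rw [sum_filter, sum_filter, ← Nat.sum_div_divisors]
    refine sum_congr rfl fun d hd => ?_
    have hd' := Nat.dvd_of_mem_divisors hd
    have hodd : Odd (2 * n / d) → ¬ Odd d := fun h h' =>
      Nat.not_even_iff_odd.mpr (h.mul h') (by rw [Nat.div_mul_cancel hd']; simp)
    rw [Nat.div_div_self hd' (by omega), min_comm]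
    exact if_congr ⟨fun h => ⟨hodd h, h⟩, And.right⟩ rfl rfl
  rw [← sum_even_divisors_two_mul hn, sdiv,
    ← sum_filter_add_sum_filter_not _ (fun d => Odd d),
    ← sum_filter_add_sum_filter_not ((2 * n).divisors.filter fun d => ¬ Odd d)
      (fun d => Odd (2 * n / d)), filter_filter, filter_filter, ← hswap,
    sum_odd_divisors_two_mul]
  ring

lemma cfun_eq {n : ℕ} (hn : n ≠ 0) :
    cfun n = (if 2 ∣ n then (sigma1 (n / 2) : ℚ) else 0) +
      ∑ d ∈ n.divisors with Odd d, ((d - 2 * (n / d) : ℕ) : ℚ) := by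
  have hsplit : ∑ d ∈ n.divisors with Odd d, d = ∑ d ∈ n.divisors with Odd d, (d - 2 * (n / d)) +
      ∑ d ∈ n.divisors with Odd d, min d (2 * (n / d)) := by
    rw [← sum_add_distrib]
    exact sum_congr rfl fun d _ => by omega
  have hσ := sigma1_eq hn
  have hs := sdiv_two_mul hn
  rw [hsplit] at hσ
  rw [cfun, hσ, hs, ← Nat.cast_sum]
  split_ifs <;> push_cast <;> ring

lemma sum_Icc_dvd_eq_sum_divisors {M : Type*} [AddCommMonoid M] (n : ℕ) (f : ℕ → M) :
    ∑ r ∈ Icc 1 n, (if r ∣ n then f r else 0) = ∑ d ∈ n.divisors, f d := by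
  rw [← sum_filter]
  refine sum_congr ?_ fun _ _ => rfl
  ext d
  simp only [mem_filter, mem_Icc, Nat.mem_divisors]
  constructor
  · rintro ⟨⟨h1, h2⟩, h3⟩
    exact ⟨h3, by omega⟩
  · rintro ⟨h1, h2⟩
    exact ⟨⟨Nat.pos_of_dvd_of_pos h1 (by omega), Nat.le_of_dvd (by omega) h1⟩, h1⟩

lemma coeff_sum_lambert (n : ℕ) :
    coeff n (∑ m ∈ Icc 1 n, lambert (2 * m)) = if 2 ∣ n then (sigma1 (n / 2) : ℚ) else 0 := by
  rw [map_sum]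
  have h : ∀ m ∈ Icc 1 n, coeff n (lambert (2 * m)) =
      if 2 * m ∣ n then ((n / (2 * m) : ℕ) : ℚ) else 0 := fun m hm =>
    coeff_lambert (by have := (mem_Icc.mp hm).1; omega) n
  rw [sum_congr rfl h]
  split_ifs with h2
  · obtain ⟨k, rfl⟩ := h2
    simp only [Nat.mul_dvd_mul_iff_left two_pos, Nat.mul_div_mul_left _ _ two_pos]
    rw [Nat.mul_div_cancel_left _ two_pos, sigma1, ← Nat.sum_div_divisors, Nat.cast_sum,
      ← sum_Icc_dvd_eq_sum_divisors]
    refine (sum_subset (Icc_subset_Icc_right (by omega)) fun r hr hr' => ?_).symm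
    simp only [mem_Icc, not_and, not_le] at hr hr'
    exact if_neg (Nat.not_dvd_of_pos_of_lt (by omega) (hr' hr.1))
  · exact sum_eq_zero fun m _ => if_neg fun h => h2 ((dvd_mul_right 2 m).trans h)

lemma coeff_sum_alpha_mul_lambert (n : ℕ) :
    coeff n (∑ r ∈ Icc 1 n, alpha r * lambert (2 * r)) =
      ∑ d ∈ n.divisors with Odd d, ((d - 2 * (n / d) : ℕ) : ℚ) := by
  rw [map_sum, sum_filter, ← Nat.sum_div_divisors, ← sum_Icc_dvd_eq_sum_divisors]
  refine sum_congr rfl fun r hr => ?_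
  obtain ⟨h1, h2⟩ := mem_Icc.mp hr
  rw [coeff_alpha_mul_lambert (by omega), ite_and]
  refine ite_congr rfl (fun h => ?_) fun _ => rfl
  rw [Nat.div_div_self h (by omega)]

lemma coeff_psi_mul_sptSeries {n : ℕ} (hn : n ≠ 0) : coeff n (psi n * sptSeries n) = cfun n := by
  have h := X_pow_dvd_iff.mp (X_pow_dvd_psi_mul_sptSeries_sub n) n (Nat.lt_succ_self n)
  rw [map_sub, map_add, coeff_sum_lambert, coeff_sum_alpha_mul_lambert, ← cfun_eq hn] at h
  exact sub_eq_zero.mp h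

/-- The signed weight of `j ≥ 1` copies of the part `i` in partitions without repeated odd parts. -/
def partWeight (i j : ℕ) : ℚ := if Even i then 1 else if j = 1 then -1 else 0

/-- The weight selecting partitions with parts in `[a, b]`, in which `j ≥ 1` copies of the part `a`
are weighted by `c j`. -/
def boundedWeight (a b : ℕ) (c : ℕ → ℚ) (i j : ℕ) : ℚ :=
  if i ∈ Ioc a b then partWeight i j else if i = a then c j else 0

section genFun

open scoped PowerSeries.WithPiTopology
open Nat.Partition (genFun genFun_eq_tprod summable_genFun_term')

lemma genFun_eq_prod {f : ℕ → ℕ → ℚ} {a b : ℕ} (hf : ∀ i ∉ Ioc a b, ∀ j, f i j = 0) :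
    genFun f = ∏ i ∈ Ioc a b, (1 + ∑' j, f i (j + 1) • (X : ℚ⟦X⟧) ^ (i * (j + 1))) := by
  rw [genFun_eq_tprod, tprod_eq_prod (s := Ico a b)]
  · rw [← prod_image (s := Ico a b) (g := (· + 1))
      (f := fun i => (1 + ∑' j, f i (j + 1) • (X : ℚ⟦X⟧) ^ (i * (j + 1))))
      (by intro x _ y _ h; simpa using h)]
    refine prod_congr ?_ fun _ _ => rfl
    ext x
    simp only [mem_image, mem_Ico, mem_Ioc]
    exact ⟨by rintro ⟨y, hy, rfl⟩; omega, fun h => ⟨x - 1, by omega, by omega⟩⟩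
  · intro i hi
    have : i + 1 ∉ Ioc a b := by simp only [mem_Ico, mem_Ioc] at hi ⊢; omega
    simp [hf _ this]

lemma tsum_X_pow_mul {i : ℕ} (hi : i ≠ 0) :
    (∑' j, (X : ℚ⟦X⟧) ^ (i * (j + 1))) * (1 - X ^ i) = X ^ i := by
  have hs : Summable fun j => (X : ℚ⟦X⟧) ^ (i * (j + 1)) := by
    simpa using summable_genFun_term' (R := ℚ) (fun _ _ => 1) hi
  have h := hs.tsum_eq_zero_add
  have h2 : ∀ j, (X : ℚ⟦X⟧) ^ (i * (j + 1 + 1)) = X ^ i * X ^ (i * (j + 1)) := fun j => by ring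
  simp only [h2, hs.tsum_mul_left] at h
  rw [zero_add, mul_one] at h
  linear_combination h

lemma tsum_nsmul_X_pow_mul {i : ℕ} (hi : i ≠ 0) :
    ∑' j : ℕ, ((j + 1 : ℕ) : ℚ) • (X : ℚ⟦X⟧) ^ (i * (j + 1)) = lambert i := by
  have hs : Summable fun j => (X : ℚ⟦X⟧) ^ (i * (j + 1)) := by
    simpa using summable_genFun_term' (R := ℚ) (fun _ _ => 1) hi
  have hT : Summable fun j : ℕ => ((j + 1 : ℕ) : ℚ) • (X : ℚ⟦X⟧) ^ (i * (j + 1)) :=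
    summable_genFun_term' (R := ℚ) (fun _ j => (j : ℚ)) hi
  have h := hT.tsum_eq_zero_add
  have h2 : ∀ j : ℕ, ((j + 1 + 1 : ℕ) : ℚ) • (X : ℚ⟦X⟧) ^ (i * (j + 1 + 1)) =
      X ^ i * (((j + 1 : ℕ) : ℚ) • X ^ (i * (j + 1))) + X ^ i * X ^ (i * (j + 1)) := fun j => by
    rw [Nat.cast_succ (j + 1), add_smul, one_smul, mul_smul_comm, ← pow_add,
      show i + i * (j + 1) = i * (j + 1 + 1) by ring]
  simp only [h2] at h
  rw [(hT.mul_left _).tsum_add (hs.mul_left _), hT.tsum_mul_left, hs.tsum_mul_left] at h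
  have hS := tsum_X_pow_mul hi
  have hl := lambert_mul hi
  have hne : (1 - X ^ i : ℚ⟦X⟧) ^ 2 ≠ 0 := by
    refine pow_ne_zero 2 fun h0 => ?_
    have := one_sub_X_pow_mul_inv hi
    simp [h0] at this
  refine mul_right_cancel₀ hne ?_
  rw [hl]
  simp only [zero_add, mul_one, Nat.cast_one, one_smul] at h
  linear_combination (1 - X ^ i) * h + X ^ i * hS

lemma one_add_tsum_partWeight {i : ℕ} (hi : i ≠ 0) :
    1 + ∑' j, partWeight i (j + 1) • (X : ℚ⟦X⟧) ^ (i * (j + 1)) = factor i := by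
  by_cases h : Even i
  · simp only [partWeight, factor, if_pos h, one_smul]
    have hS := tsum_X_pow_mul hi
    have hinv := one_sub_X_pow_mul_inv hi
    linear_combination (1 - X ^ i : ℚ⟦X⟧)⁻¹ * hS -
      (1 + ∑' j, (X : ℚ⟦X⟧) ^ (i * (j + 1))) * hinv
  · simp only [partWeight, factor, if_neg h]
    rw [tsum_eq_single 0 (by intro j hj; simp [hj])]
    simp [sub_eq_add_neg]

lemma genFun_boundedWeight {a b : ℕ} (ha : a ≠ 0) (hab : a ≤ b) (c : ℕ → ℚ) :
    genFun (boundedWeight a b c) =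
      (1 + ∑' j, c (j + 1) • (X : ℚ⟦X⟧) ^ (a * (j + 1))) * ∏ i ∈ Ioc a b, factor i := by
  have hins : Ioc (a - 1) b = insert a (Ioc a b) := by
    ext x; simp only [mem_Ioc, mem_insert]; omega
  rw [genFun_eq_prod (a := a - 1) (b := b), hins, prod_insert (by simp)]
  · congr 1
    · simp [boundedWeight]
    · refine prod_congr rfl fun i hi => ?_
      have : i ≠ 0 := by have := (mem_Ioc.mp hi).1; omega
      simp only [boundedWeight, if_pos hi, one_add_tsum_partWeight this]
  · intro i hi j
    rw [hins, mem_insert, not_or] at hi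
    simp [boundedWeight, hi.1, hi.2]

lemma lambert_mul_prod_factor {a b : ℕ} (ha : a ≠ 0) (hab : a ≤ b) :
    lambert a * ∏ i ∈ Ioc a b, factor i =
      genFun (boundedWeight a b fun j => j) - genFun (boundedWeight a b fun _ => 0) := by
  rw [genFun_boundedWeight ha hab, genFun_boundedWeight ha hab, tsum_nsmul_X_pow_mul ha]
  simp
  ring

end genFun

lemma smallestPart_eq_iff {n : ℕ} (π : n.Partition) {a : ℕ} (ha : a ≠ 0) :
    π.smallestPart = a ↔ a ∈ π.parts ∧ ∀ i ∈ π.parts, a ≤ i := by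
  rw [Nat.Partition.smallestPart]
  constructor
  · rintro rfl
    have hne : {a | a ∈ π.parts}.Nonempty := by
      by_contra h
      simp [Set.not_nonempty_iff_eq_empty.mp h] at ha
    exact ⟨Nat.sInf_mem hne, fun i hi => Nat.sInf_le hi⟩
  · rintro ⟨h1, h2⟩
    exact le_antisymm (Nat.sInf_le h1) (h2 _ (Nat.sInf_mem (s := {a | a ∈ π.parts}) ⟨a, h1⟩))

lemma prod_partWeight {n : ℕ} (π : n.Partition) :
    ∏ i ∈ π.parts.toFinset, partWeight i (π.parts.count i) =
      if ∀ i ∈ π.parts, Odd i → π.parts.count i ≤ 1 then (-1) ^ n else 0 := by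
  split_ifs with h
  · have hsum : ∑ i ∈ π.parts.toFinset, π.parts.count i * i = n := by
      simpa [π.parts_sum] using (sum_multiset_count π.parts).symm
    conv_rhs => rw [← hsum, ← prod_pow_eq_pow_sum]
    refine prod_congr rfl fun i hi => ?_
    rw [Multiset.mem_toFinset] at hi
    by_cases hi2 : Even i
    · simp [partWeight, hi2]
    · have hodd := Nat.not_even_iff_odd.mp hi2
      have hc : π.parts.count i = 1 :=
        le_antisymm (h i hi hodd) (Multiset.one_le_count_iff_mem.mpr hi)
      simp [partWeight, hi2, hc, hodd.neg_one_pow]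
  · push Not at h
    obtain ⟨i, hi, hodd, hc⟩ := h
    refine prod_eq_zero (Multiset.mem_toFinset.mpr hi) ?_
    simp [partWeight, Nat.not_even_iff_odd.mpr hodd, hc.ne']

lemma prod_boundedWeight_sub {n a b : ℕ} (π : n.Partition) (ha : a ≠ 0) (ha2 : Even a)
    (hb : n ≤ b) :
    π.parts.toFinsupp.prod (boundedWeight a b fun j => j) -
      π.parts.toFinsupp.prod (boundedWeight a b fun _ => 0) =
      if (∀ i ∈ π.parts, Odd i → π.parts.count i ≤ 1) ∧ π.smallestPart = a then
        (-1) ^ n * (π.parts.count a : ℚ) else 0 := by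
  simp only [Finsupp.prod, Multiset.toFinsupp_support, Multiset.toFinsupp_apply]
  by_cases hge : ∀ i ∈ π.parts, a ≤ i
  · have hmem : ∀ i ∈ π.parts, i ≠ a → i ∈ Ioc a b := fun i hi hia =>
      mem_Ioc.mpr ⟨lt_of_le_of_ne (hge i hi) hia.symm, (π.le_of_mem_parts hi).trans hb⟩
    by_cases ham : a ∈ π.parts
    · have ham' : a ∈ π.parts.toFinset := Multiset.mem_toFinset.mpr ham
      have hrest (c : ℕ → ℚ) : ∏ i ∈ π.parts.toFinset, boundedWeight a b c i (π.parts.count i) =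
          c (π.parts.count a) * ∏ i ∈ π.parts.toFinset, partWeight i (π.parts.count i) := by
        rw [← mul_prod_erase _ _ ham',
          ← mul_prod_erase _ (fun i => partWeight i (π.parts.count i)) ham']
        rw [show partWeight a (π.parts.count a) = 1 from if_pos ha2, one_mul]
        congr 1
        · simp [boundedWeight]
        · refine prod_congr rfl fun i hi => ?_
          rw [mem_erase, Multiset.mem_toFinset] at hi
          exact if_pos (hmem i hi.2 hi.1)
      rw [hrest, hrest, prod_partWeight, (smallestPart_eq_iff π ha).mpr ⟨ham, hge⟩]
      simp only [and_true]
      split_ifs <;> ring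
    · rw [if_neg fun h => ham ((smallestPart_eq_iff π ha).mp h.2).1, sub_eq_zero]
      refine prod_congr rfl fun i hi => ?_
      rw [Multiset.mem_toFinset] at hi
      have := hmem i hi fun h => ham (h ▸ hi)
      simp [boundedWeight, this]
  · rw [if_neg fun h => hge ((smallestPart_eq_iff π ha).mp h.2).2]
    push Not at hge
    obtain ⟨i, hi, hia⟩ := hge
    have h0 (c : ℕ → ℚ) : boundedWeight a b c i (π.parts.count i) = 0 := by
      simp [boundedWeight, hia.ne, hia.le]
    rw [prod_eq_zero (Multiset.mem_toFinset.mpr hi) (h0 _),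
      prod_eq_zero (Multiset.mem_toFinset.mpr hi) (h0 _), sub_zero]

lemma coeff_sptSeries {n N : ℕ} (hn : n ≤ N) :
    coeff n (sptSeries N) = (-1) ^ n * (M2spt n : ℚ) := by
  have hterm : ∀ m ∈ Icc 1 N, coeff n (lambert (2 * m) * ∏ i ∈ Ioc (2 * m) (2 * N), factor i) =
      ∑ π : n.Partition,
        if (∀ i ∈ π.parts, Odd i → π.parts.count i ≤ 1) ∧ π.smallestPart = 2 * m then
          (-1) ^ n * (π.parts.count (2 * m) : ℚ) else 0 := by
    intro m hm
    obtain ⟨h1, h2⟩ := mem_Icc.mp hm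
    rw [lambert_mul_prod_factor (by omega) (by omega), map_sub, Nat.Partition.coeff_genFun,
      Nat.Partition.coeff_genFun, ← sum_sub_distrib]
    exact sum_congr rfl fun π _ =>
      prod_boundedWeight_sub π (by omega) (even_two_mul m) (by omega)
  rw [sptSeries, map_sum, sum_congr rfl hterm, sum_comm, M2spt, Nat.cast_sum, mul_sum]
  refine sum_congr rfl fun π _ => ?_
  split_ifs with h
  · obtain ⟨hrep, ⟨m, hm⟩, hne⟩ := h
    rw [← two_mul] at hm
    obtain ⟨i, hi⟩ := Multiset.exists_mem_of_ne_zero hne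
    have hmem : π.smallestPart ∈ π.parts :=
      Nat.sInf_mem (s := {a | a ∈ π.parts}) ⟨i, hi⟩
    have hpos := π.parts_pos hmem
    have hle := π.le_of_mem_parts hmem
    rw [sum_eq_single_of_mem m (mem_Icc.mpr ⟨by omega, by omega⟩)]
    · rw [if_pos ⟨hrep, hm⟩, hm]
    · intro k _ hk
      exact if_neg fun h => hk (by omega)
  · rw [Nat.cast_zero, mul_zero]
    refine sum_eq_zero fun m hm => if_neg fun h' => h ⟨h'.1, by simp [h'.2], fun h0 => ?_⟩
    have := ((smallestPart_eq_iff π (by have := (mem_Icc.mp hm).1; omega)).mp h'.2).1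
    simp [h0] at this

lemma finsum_eq_coeff (n : ℕ) :
    ∑ᶠ k : ℕ, (-1 : ℚ) ^ (k * (k + 1) / 2) * M2sptQ ((n : ℤ) - (k * (k + 1) / 2 : ℕ)) =
      (-1) ^ n * coeff n (psi n * sptSeries n) := by
  have hk (k : ℕ) : k ≤ k * (k + 1) / 2 := by
    rw [Nat.le_div_iff_mul_le two_pos]
    nlinarith [Nat.le_mul_self k]
  rw [finsum_eq_sum_of_support_subset (s := range (2 * n + 1)), psi, sum_mul, map_sum, mul_sum]
  · refine sum_congr rfl fun k _ => ?_
    rw [coeff_X_pow_mul', M2sptQ]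
    by_cases h : k * (k + 1) / 2 ≤ n
    · rw [if_pos h, if_pos (by omega), coeff_sptSeries (Nat.sub_le _ _),
        ← Nat.cast_sub h, Int.toNat_natCast, ← mul_assoc, ← pow_add]
      congr 1
      rw [show n + (n - k * (k + 1) / 2) = 2 * (n - k * (k + 1) / 2) + k * (k + 1) / 2 by omega,
        pow_add]
      simp
    · rw [if_neg h, if_neg (by omega)]
      simp
  · intro k hk0
    rw [Function.mem_support] at hk0
    by_contra hkn
    refine hk0 ?_
    have hkn : ¬ k < 2 * n + 1 := by simpa using hkn
    have := hk k
    rw [M2sptQ, if_neg (by omega), mul_zero]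

end M2SptRecurrence

/-- Euler-like recurrence for `M2spt` (Theorem 3). -/
theorem m2spt_recurrence (n : ℕ) (hn : 0 < n) :
    ∑ᶠ k : ℕ, (-1 : ℚ) ^ (k * (k + 1) / 2) * M2sptQ ((n : ℤ) - (k * (k + 1) / 2 : ℕ))
      = (-1) ^ n * cfun n := by
  rw [M2SptRecurrence.finsum_eq_coeff, M2SptRecurrence.coeff_psi_mul_sptSeries hn.ne']
end
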